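/- arXiv:1101.3282 — 3 statements merged into one kernel-verified Lean document; each statement's English description precedes it below -/
import Mathlib

section
/- A totally umbilical biharmonic surface in any 3-dimensional Riemannian manifold has constant mean curvature. -/
/-!
Coordinate-based Riemannian geometry on charts `ℝⁿ`, enough to express mean
curvature, second fundamental forms, curvature tensors and the (bi)tension
fields of isometric immersions, as used in
"Constant mean curvature and totally umbilical biharmonic surfaces in
3-dimensional geometries".
-/

noncomputable section

open scoped BigOperators

/-- A point of the coordinate chart `ℝⁿ`. -/
abbrev Pt (n : ℕ) := Fin n → ℝ

/-- A Riemannian metric on (an open part of) `ℝⁿ`, given by its coordinate matrix. -/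
abbrev Met (n : ℕ) := Pt n → Matrix (Fin n) (Fin n) ℝ

/-- A vector field on `ℝⁿ`, in coordinates. -/
abbrev VF (n : ℕ) := Pt n → Pt n

/-- The inner product of tangent vectors `v`, `w` at the point `p`, w.r.t. `g`. -/
def gip {n : ℕ} (g : Met n) (p v w : Pt n) : ℝ := ∑ i, ∑ j, g p i j * v i * w j

/-- `g` is a Riemannian metric: smooth, symmetric and positive definite. -/
structure IsRiemannian {n : ℕ} (g : Met n) : Prop where
  smooth : ∀ i j, ContDiff ℝ (⊤ : ℕ∞) fun p => g p i j
  symm : ∀ p i j, g p i j = g p j i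
  posdef : ∀ p v, v ≠ 0 → 0 < gip g p v v

/-- Christoffel symbols `Γ^k_{ij}` of the Levi-Civita connection of `g`. -/
def christoffel {n : ℕ} (g : Met n) (p : Pt n) (k i j : Fin n) : ℝ :=
  (1 / 2) * ∑ l, (g p)⁻¹ k l *
    (fderiv ℝ (fun q => g q j l) p (Pi.single i 1)
      + fderiv ℝ (fun q => g q i l) p (Pi.single j 1)
      - fderiv ℝ (fun q => g q i j) p (Pi.single l 1))

/-- The Levi-Civita covariant derivative `∇_X Y` of vector fields, in coordinates. -/
def cov {n : ℕ} (g : Met n) (X Y : VF n) : VF n := fun p k =>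
  fderiv ℝ (fun q => Y q k) p (X p) + ∑ i, ∑ j, christoffel g p k i j * X p i * Y p j

/-- The Lie bracket `[X, Y]` of vector fields. -/
def lieB {n : ℕ} (X Y : VF n) : VF n := fun p k =>
  fderiv ℝ (fun q => Y q k) p (X p) - fderiv ℝ (fun q => X q k) p (Y p)

/-- The curvature operator `R(X,Y)Z = ∇_X ∇_Y Z − ∇_Y ∇_X Z − ∇_{[X,Y]} Z`. -/
def curvOp {n : ℕ} (g : Met n) (X Y Z : VF n) : VF n := fun p =>
  cov g X (cov g Y Z) p - cov g Y (cov g X Z) p - cov g (lieB X Y) Z p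

/-- The curvature tensor evaluated on tangent vectors at `p` (via constant extensions). -/
def curvPt {n : ℕ} (g : Met n) (p v w z : Pt n) : Pt n :=
  curvOp g (fun _ => v) (fun _ => w) (fun _ => z) p

/-- The Ricci curvature `Ric(v, w) = trace (z ↦ R(z, v) w)` at `p`; for the Levi-Civita
connection of a Riemannian metric this agrees with `Σᵢ ⟨R(v, eᵢ) eᵢ, w⟩` for any
orthonormal frame `{eᵢ}`. -/
def ricci {n : ℕ} (g : Met n) (p v w : Pt n) : ℝ :=
  ∑ k, curvPt g p (Pi.single k 1) v w k

/-- The differential of `φ` at `u`, applied to the `a`-th coordinate direction. -/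
def dmap {m n : ℕ} (φ : Pt m → Pt n) (u : Pt m) (a : Fin m) : Pt n := fun k =>
  fderiv ℝ (fun q => φ q k) u (Pi.single a 1)

/-- The pushforward `dφ_u(v)` of a tangent vector of the domain. -/
def push {m n : ℕ} (φ : Pt m → Pt n) (u : Pt m) (v : Pt m) : Pt n := fun k =>
  fderiv ℝ (fun q => φ q k) u v

/-- The first fundamental form (induced metric) of the immersion `φ`. -/
def fff {m n : ℕ} (g : Met n) (φ : Pt m → Pt n) : Met m := fun u =>
  Matrix.of fun a b => gip g (φ u) (dmap φ u a) (dmap φ u b)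

/-- `φ` is a smooth immersion. -/
def IsImmersion {m n : ℕ} (φ : Pt m → Pt n) : Prop :=
  (∀ k, ContDiff ℝ (⊤ : ℕ∞) fun u => φ u k) ∧ ∀ u, LinearIndependent ℝ (dmap φ u)

/-- `ξ` is a (smooth) unit normal vector field along the immersion `φ`. -/
def IsUnitNormal {m n : ℕ} (g : Met n) (φ ξ : Pt m → Pt n) : Prop :=
  (∀ k, ContDiff ℝ (⊤ : ℕ∞) fun u => ξ u k) ∧ (∀ u, gip g (φ u) (ξ u) (ξ u) = 1) ∧
    ∀ u a, gip g (φ u) (ξ u) (dmap φ u a) = 0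

/-- The second fundamental form `h_{ab} = ⟨∇^N_{∂_a} dφ(∂_b), ξ⟩` of `φ` w.r.t. `ξ`. -/
def sff {m n : ℕ} (g : Met n) (φ ξ : Pt m → Pt n) (u : Pt m) (a b : Fin m) : ℝ :=
  gip g (φ u)
    (fun k => fderiv ℝ (fun q => dmap φ q b k) u (Pi.single a 1)
      + ∑ i, ∑ j, christoffel g (φ u) k i j * dmap φ u a i * dmap φ u b j)
    (ξ u)

/-- The shape operator `A^a_b = G^{ac} h_{cb}` of `φ` w.r.t. `ξ` (`G` the induced metric). -/
def shapeOp {m n : ℕ} (g : Met n) (φ ξ : Pt m → Pt n) (u : Pt m) (a b : Fin m) : ℝ :=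
  ∑ c, (fff g φ u)⁻¹ a c * sff g φ ξ u c b

/-- The mean curvature `H = (1/m) ⋅ trace A` of the hypersurface `φ` w.r.t. `ξ`. -/
def meanCurv {m n : ℕ} (g : Met n) (φ ξ : Pt m → Pt n) (u : Pt m) : ℝ :=
  (1 / (m : ℝ)) * ∑ a, shapeOp g φ ξ u a a

/-- The squared norm `|A|²` of the shape operator (= of the second fundamental form). -/
def normA2 {m n : ℕ} (g : Met n) (φ ξ : Pt m → Pt n) (u : Pt m) : ℝ :=
  ∑ a, ∑ b, shapeOp g φ ξ u a b * shapeOp g φ ξ u b a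

/-- `φ` is totally umbilical w.r.t. `ξ`: at every point both principal curvatures are
equal, i.e. the second fundamental form is a scalar multiple of the induced metric
(equivalently, the shape operator is a scalar multiple of the identity). -/
def IsTotallyUmbilical {m n : ℕ} (g : Met n) (φ ξ : Pt m → Pt n) : Prop :=
  ∃ lam : Pt m → ℝ, ∀ u a b, sff g φ ξ u a b = lam u * fff g φ u a b

/-- The tension field `τ(φ) = Trace_g ∇ dφ` of the isometric immersion `φ`
(the domain carrying the induced metric). -/
def tension {m n : ℕ} (g : Met n) (φ : Pt m → Pt n) (u : Pt m) : Pt n := fun k =>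
  ∑ a, ∑ b, (fff g φ u)⁻¹ a b *
    (fderiv ℝ (fun q => dmap φ q b k) u (Pi.single a 1)
      - ∑ c, christoffel (fff g φ) u c a b * dmap φ u c k
      + ∑ i, ∑ j, christoffel g (φ u) k i j * dmap φ u a i * dmap φ u b j)

/-- The pull-back covariant derivative `∇^φ_{∂_a} V` of a vector field `V` along `φ`. -/
def covAlong {m n : ℕ} (g : Met n) (φ : Pt m → Pt n) (V : Pt m → Pt n) (a : Fin m) :
    Pt m → Pt n := fun u k =>
  fderiv ℝ (fun q => V q k) u (Pi.single a 1)
    + ∑ i, ∑ j, christoffel g (φ u) k i j * dmap φ u a i * V u j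

/-- The bitension field
`τ₂(φ) = Trace_g (∇^φ ∇^φ − ∇^φ_{∇^M}) τ(φ) − Trace_g R^N(dφ, τ(φ)) dφ`. -/
def bitension {m n : ℕ} (g : Met n) (φ : Pt m → Pt n) (u : Pt m) : Pt n := fun k =>
  (∑ a, ∑ b, (fff g φ u)⁻¹ a b *
      (covAlong g φ (covAlong g φ (tension g φ) b) a u k
        - ∑ c, christoffel (fff g φ) u c a b * covAlong g φ (tension g φ) c u k))
    - ∑ a, ∑ b, (fff g φ u)⁻¹ a b *
        curvPt g (φ u) (dmap φ u a) (tension g φ u) (dmap φ u b) k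

/-- `φ` is a biharmonic isometric immersion: its bitension field vanishes.  (This is the
Euler–Lagrange characterisation of the critical points of the bienergy
`E²(φ,Ω) = (1/2)∫_Ω |τ(φ)|²` for every compact `Ω`.) -/
def IsBiharmonic {m n : ℕ} (g : Met n) (φ : Pt m → Pt n) : Prop := ∀ u, bitension g φ u = 0

/-- `φ` is minimal (equivalently, harmonic): its tension field vanishes, i.e. `H ≡ 0`. -/
def IsMinimal {m n : ℕ} (g : Met n) (φ : Pt m → Pt n) : Prop := ∀ u, tension g φ u = 0

/-- `φ` is proper biharmonic: biharmonic and not minimal. -/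
def IsProperBiharmonic {m n : ℕ} (g : Met n) (φ : Pt m → Pt n) : Prop :=
  IsBiharmonic g φ ∧ ¬IsMinimal g φ

/-! ### The Bianchi–Cartan–Vranceanu spaces `M³_{m,l}`, Sol, hyperbolic and flat space -/

/-- `F = 1 + m (x² + y²)`. -/
def bcvF (m : ℝ) (p : Pt 3) : ℝ := 1 + m * (p 0 ^ 2 + p 1 ^ 2)

/-- The coordinate covector of the one-form `dz + (l/2)(y dx − x dy)/F`. -/
def bcvω (m l : ℝ) (p : Pt 3) : Pt 3 :=
  ![l * p 1 / (2 * bcvF m p), -(l * p 0) / (2 * bcvF m p), 1]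

/-- The Bianchi–Cartan–Vranceanu metric
`g = (dx² + dy²)/(1 + m(x²+y²))² + (dz + (l/2)(y dx − x dy)/(1 + m(x²+y²)))²` on `ℝ³`. -/
def bcvMet (m l : ℝ) : Met 3 := fun p =>
  Matrix.of fun i j =>
    (if i = j ∧ (i : ℕ) < 2 then 1 / bcvF m p ^ 2 else 0) + bcvω m l p i * bcvω m l p j

/-- The frame `E₁ = F ∂_x − (l y/2) ∂_z`, `E₂ = F ∂_y + (l x/2) ∂_z`, `E₃ = ∂_z`
on the BCV space `M³_{m,l}`. -/
def bcvE (m l : ℝ) : Fin 3 → VF 3 :=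
  ![fun p => ![bcvF m p, 0, -(l * p 1) / 2],
    fun p => ![0, bcvF m p, l * p 0 / 2],
    fun _ => ![0, 0, 1]]

/-- The base metric `h = (dx² + dy²)/(1 + m(x²+y²))²` on `ℝ²` of the BCV Riemannian
submersion `π : M³_{m,l} → (ℝ², h)`, `π(x,y,z) = (x,y)`. -/
def bcvBase (m : ℝ) : Met 2 := fun p =>
  Matrix.of fun i j => if i = j then 1 / (1 + m * (p 0 ^ 2 + p 1 ^ 2)) ^ 2 else 0

/-- The geodesic curvature of a unit-speed curve `α` in `(ℝ², h)`, with respect to the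
unit normal obtained by rotating `α'` by `+π/2` (a Euclidean rotation, which is also an
`h`-rotation since `h` is conformal to the flat metric). -/
def geodCurv (m : ℝ) (α : ℝ → Pt 2) (s : ℝ) : ℝ :=
  gip (bcvBase m) (α s)
    (fun k => deriv (fun t => deriv α t k) s
      + ∑ i, ∑ j, christoffel (bcvBase m) (α s) k i j * deriv α s i * deriv α s j)
    ![-deriv α s 1, deriv α s 0]

/-- `φ` parametrises part of the Hopf cylinder `π⁻¹(α(I))` over a circle of radius
`1/√(8m − l²)` in the base sphere `S²(1/(2√m))`, identified with `(ℝ², h)`.  (In the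
base sphere, which has Gaussian curvature `4m` and extrinsic normal curvature `2√m`,
the circles of radius `1/√(8m − l²)` are exactly the curves of constant geodesic
curvature `κ₀` with `κ₀² = (8m − l²) − 4m = 4m − l²`.) -/
def PartOfHopfCylinderOverCircle (m l : ℝ) (φ : Pt 2 → Pt 3) : Prop :=
  ∃ α : ℝ → Pt 2, ContDiff ℝ (⊤ : ℕ∞) α ∧
    (∀ s, gip (bcvBase m) (α s) (deriv α s) (deriv α s) = 1) ∧
    (∃ κ₀ : ℝ, κ₀ ^ 2 = 4 * m - l ^ 2 ∧ ∀ s, geodCurv m α s = κ₀) ∧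
    ∀ u, ∃ s, φ u 0 = α s 0 ∧ φ u 1 = α s 1

/-- The Sol metric `g_{Sol} = e^{2z} dx² + e^{−2z} dy² + dz²` on `ℝ³`. -/
def solMet : Met 3 := fun p =>
  Matrix.of fun i j =>
    if i = j then
      if (i : ℕ) = 0 then Real.exp (2 * p 2)
      else if (i : ℕ) = 1 then Real.exp (-(2 * p 2)) else 1
    else 0

/-- The orthonormal frame `E₁ = e^{−z} ∂_x`, `E₂ = e^{z} ∂_y`, `E₃ = ∂_z` on Sol space. -/
def solE : Fin 3 → VF 3 :=
  ![fun p => ![Real.exp (-p 2), 0, 0],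
    fun p => ![0, Real.exp (p 2), 0],
    fun _ => ![0, 0, 1]]

/-- Hyperbolic 3-space `H³` in horospherical coordinates: `g = e^{2z}(dx² + dy²) + dz²`. -/
def hypMet : Met 3 := fun p =>
  Matrix.of fun i j => if i = j then (if (i : ℕ) < 2 then Real.exp (2 * p 2) else 1) else 0

/-- The flat metric on `ℝ³`. -/
def euclMet : Met 3 := fun _ => 1

section Abstract
open scoped ContDiff
variable {E F : Type*} [NormedAddCommGroup E] [NormedSpace ℝ E]
  [NormedAddCommGroup F] [NormedSpace ℝ F]

/-- Covariant derivative along a map, abstract version. -/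
def acd (B : E → E →L[ℝ] E →L[ℝ] E) (φ V : F → E) (e : F) (u : F) : E :=
  fderiv ℝ V u e + B (φ u) (fderiv ℝ φ u e) (V u)

/-- Curvature, abstract version. -/
def aR (B : E → E →L[ℝ] E →L[ℝ] E) (p x y z : E) : E :=
  fderiv ℝ B p x y z - fderiv ℝ B p y x z + B p x (B p y z) - B p y (B p x z)

theorem smooth_fderiv_apply {f : F → E} (hf : ContDiff ℝ ∞ f) (e : F) :
    ContDiff ℝ ∞ (fun u => fderiv ℝ f u e) :=
  (hf.fderiv_right (m := ∞) (by simp)).clm_apply contDiff_const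

theorem ContDiff.dAt {f : F → E} (hf : ContDiff ℝ ∞ f) (u : F) : DifferentiableAt ℝ f u :=
  (hf.differentiable (by simp)).differentiableAt

theorem smooth_acd {B : E → E →L[ℝ] E →L[ℝ] E} (hB : ContDiff ℝ ∞ B) {φ V : F → E}
    (hφ : ContDiff ℝ ∞ φ) (hV : ContDiff ℝ ∞ V) (e : F) : ContDiff ℝ ∞ (acd B φ V e) :=
  (smooth_fderiv_apply hV e).add
    (((hB.comp hφ).clm_apply (smooth_fderiv_apply hφ e)).clm_apply hV)

theorem fderiv2 {E' : Type*} [NormedAddCommGroup E'] [NormedSpace ℝ E']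
    {B : E → E →L[ℝ] E →L[ℝ] E'} (hB : ContDiff ℝ ∞ B) {φ V W : F → E}
    (hφ : ContDiff ℝ ∞ φ) (hV : ContDiff ℝ ∞ V) (hW : ContDiff ℝ ∞ W) (e u : F) :
    fderiv ℝ (fun q => B (φ q) (V q) (W q)) u e =
      fderiv ℝ B (φ u) (fderiv ℝ φ u e) (V u) (W u) + B (φ u) (fderiv ℝ V u e) (W u)
        + B (φ u) (V u) (fderiv ℝ W u e) := by
  have h1 : HasFDerivAt (fun q => B (φ q)) ((fderiv ℝ B (φ u)).comp (fderiv ℝ φ u)) u :=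
    (hB.dAt (φ u)).hasFDerivAt.comp u (hφ.dAt u).hasFDerivAt
  have h2 := (h1.clm_apply (hV.dAt u).hasFDerivAt).clm_apply (hW.dAt u).hasFDerivAt
  rw [h2.fderiv]
  simp
  abel

theorem fderiv_symm {f : F → E} (hf : ContDiff ℝ ∞ f) (u e e' : F) :
    fderiv ℝ (fun q => fderiv ℝ f q e) u e' = fderiv ℝ (fun q => fderiv ℝ f q e') u e := by
  have h : ∀ e, fderiv ℝ (fun q => fderiv ℝ f q e) u = (fderiv ℝ (fderiv ℝ f) u).flip e := by
    intro e
    have := (((hf.fderiv_right (m := ∞) (by simp)).dAt u).hasFDerivAt.clm_apply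
      (hasFDerivAt_const e u)).fderiv
    rw [this]; ext; simp
  rw [h, h]
  exact (hf.contDiffAt.isSymmSndFDerivAt (by rw [minSmoothness_of_isRCLikeNormedField]; exact WithTop.coe_le_coe.2 (le_top : (2 : ℕ∞) ≤ ⊤))) _ _

variable {B : E → E →L[ℝ] E →L[ℝ] E} (hB : ContDiff ℝ ∞ B)
  (hBs : ∀ p x y, B p x y = B p y x)
  {G : E → E →L[ℝ] E →L[ℝ] ℝ} (hG : ContDiff ℝ ∞ G)
  (hGs : ∀ p x y, G p x y = G p y x)
  (hGB : ∀ p x v w, fderiv ℝ G p x v w = G p (B p x v) w + G p v (B p x w))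

include hG hGB in
theorem acd_compat {φ V W : F → E} (hφ : ContDiff ℝ ∞ φ) (hV : ContDiff ℝ ∞ V)
    (hW : ContDiff ℝ ∞ W) (e u : F) :
    fderiv ℝ (fun q => G (φ q) (V q) (W q)) u e
      = G (φ u) (acd B φ V e u) (W u) + G (φ u) (V u) (acd B φ W e u) := by
  rw [fderiv2 hG hφ hV hW, hGB]
  simp [acd]
  ring

include hBs in
theorem acd_torsion {φ : F → E} (hφ : ContDiff ℝ ∞ φ) (e f u : F) :
    acd B φ (fun q => fderiv ℝ φ q f) e u = acd B φ (fun q => fderiv ℝ φ q e) f u := by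
  simp only [acd]
  rw [fderiv_symm hφ, hBs]

include hB in
theorem acd_acd {φ V : F → E} (hφ : ContDiff ℝ ∞ φ) (hV : ContDiff ℝ ∞ V) (e f u : F) :
    acd B φ (acd B φ V f) e u - acd B φ (acd B φ V e) f u
      = aR B (φ u) (fderiv ℝ φ u e) (fderiv ℝ φ u f) (V u) := by
  have key : ∀ e f, acd B φ (acd B φ V f) e u =
      fderiv ℝ (fun q => fderiv ℝ V q f) u e +
      (fderiv ℝ B (φ u) (fderiv ℝ φ u e) (fderiv ℝ φ u f) (V u) +
        B (φ u) (fderiv ℝ (fun q => fderiv ℝ φ q f) u e) (V u)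
        + B (φ u) (fderiv ℝ φ u f) (fderiv ℝ V u e)) +
      (B (φ u) (fderiv ℝ φ u e) (fderiv ℝ V u f) +
        B (φ u) (fderiv ℝ φ u e) (B (φ u) (fderiv ℝ φ u f) (V u))) := by
    intro e f
    rw [← fderiv2 hB hφ (smooth_fderiv_apply hφ f) hV]
    have h2 : ContDiff ℝ ∞ (fun q => B (φ q) (fderiv ℝ φ q f) (V q)) :=
      ((hB.comp hφ).clm_apply (smooth_fderiv_apply hφ f)).clm_apply hV
    have : fderiv ℝ (acd B φ V f) u e = fderiv ℝ (fun q => fderiv ℝ V q f) u e +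
        fderiv ℝ (fun q => B (φ q) (fderiv ℝ φ q f) (V q)) u e := by
      have := fderiv_add ((smooth_fderiv_apply hV f).dAt u) (h2.dAt u)
      rw [← add_apply, ← this]
      rfl
    rw [acd, this]
    simp [acd]
  rw [key, key, fderiv_symm hV u e f, fderiv_symm hφ u e f, aR]
  abel

theorem acd_smul {φ V : F → E} {f : F → ℝ} (hf : ContDiff ℝ ∞ f)
    (hV : ContDiff ℝ ∞ V) (e u : F) :
    acd B φ (fun q => f q • V q) e u = fderiv ℝ f u e • V u + f u • acd B φ V e u := by
  simp only [acd]
  rw [fderiv_fun_smul (hf.dAt u) (hV.dAt u)]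
  simp
  module

theorem acd_add {φ V W : F → E} (hV : ContDiff ℝ ∞ V) (hW : ContDiff ℝ ∞ W) (e u : F) :
    acd B φ (fun q => V q + W q) e u = acd B φ V e u + acd B φ W e u := by
  simp only [acd]
  rw [fderiv_fun_add (hV.dAt u) (hW.dAt u)]
  simp
  abel

theorem aR_skew12 (p x y z : E) : aR B p x y z = - aR B p y x z := by
  simp only [aR]; abel

include hB hBs in
theorem aR_bianchi (p x y z : E) : aR B p x y z + aR B p y z x + aR B p z x y = 0 := by
  have h : ∀ v x y, fderiv ℝ B p v x y = fderiv ℝ B p v y x := by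
    intro v x y
    have h1 : ∀ x y, fderiv ℝ (fun q => B q x y) p v = fderiv ℝ B p v x y := by
      intro x y
      have := fderiv2 hB (F := E) contDiff_id (contDiff_const (c := x)) (contDiff_const (c := y)) v p
      simpa using this
    rw [← h1, ← h1]
    simp_rw [hBs _ x y]
  simp only [aR]
  rw [h x y z, h y z x, h z x y, hBs p y z, hBs p z x, hBs p x y]
  abel

include hB hG hGB in
theorem aR_skew34 (p x y z w : E) : G p (aR B p x y z) w = - G p z (aR B p x y w) := by
  have hid : ContDiff ℝ ∞ (fun q : E => q) := contDiff_id
  have hz : ContDiff ℝ ∞ (fun _ : E => z) := contDiff_const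
  have hw : ContDiff ℝ ∞ (fun _ : E => w) := contDiff_const
  have c1 := acd_acd hB hid hz x y p
  have c2 := acd_acd hB hid hw x y p
  simp only [fderiv_fun_id, ContinuousLinearMap.id_apply] at c1 c2
  have hf : ContDiff ℝ ∞ (fun q : E => G q z w) := (hG.clm_apply hz).clm_apply hw
  have key : ∀ x y, fderiv ℝ (fun q => fderiv ℝ (fun q : E => G q z w) q y) p x = 
     G p (acd B (fun q => q) (acd B (fun q => q) (fun _ => z) y) x p) w
     + G p (acd B (fun q => q) (fun _ => z) y p) (acd B (fun q => q) (fun _ => w) x p)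
     + (G p (acd B (fun q => q) (fun _ => z) x p) (acd B (fun q => q) (fun _ => w) y p)
     + G p z (acd B (fun q => q) (acd B (fun q => q) (fun _ => w) y) x p)) := by
    intro x y
    have h1 : (fun q => fderiv ℝ (fun q : E => G q z w) q y) =
      fun q => G q (acd B (fun q => q) (fun _ => z) y q) w
        + G q z (acd B (fun q => q) (fun _ => w) y q) := by
      ext q
      exact acd_compat hG hGB hid hz hw y q
    have sz := smooth_acd hB hid hz y
    have sw := smooth_acd hB hid hw y
    rw [h1, fderiv_fun_add (((hG.clm_apply sz).clm_apply hw).dAt p)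
      (((hG.clm_apply hz).clm_apply sw).dAt p), add_apply]
    rw [acd_compat hG hGB hid sz hw x p, acd_compat hG hGB hid hz sw x p]
  have s := fderiv_symm hf p y x
  rw [key, key] at s
  rw [← c1, ← c2]
  simp only [map_sub, sub_apply]
  linarith

include hB hBs hG hGs hGB in
theorem aR_pair (p x y z w : E) : G p (aR B p x y z) w = G p (aR B p z w x) y := by
  have b : ∀ x y z w, G p (aR B p x y z) w + G p (aR B p y z x) w + G p (aR B p z x y) w = 0 := by
    intro x y z w
    have := congrArg (fun t => G p t w) (aR_bianchi hB hBs p x y z)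
    simpa using this
  have s12 : ∀ x y z w, G p (aR B p x y z) w = - G p (aR B p y x z) w := by
    intro x y z w
    rw [aR_skew12]; simp
  have s34 : ∀ x y z w, G p (aR B p x y z) w = - G p (aR B p x y w) z := by
    intro x y z w
    rw [aR_skew34 hB hG hGB, hGs]
  have b1 := b x y z w
  have b2 := b y z w x
  have b3 := b z w x y
  have b4 := b w x y z
  linarith [s12 x y z w, s12 y z x w, s12 z x y w, s34 x y z w, s34 y z x w, s34 z x y w,
    s34 y z w x, s34 z w y x, s34 w y z x, s34 z w x y, s34 w x z y, s34 x z w y,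
    s34 w x y z, s34 x y w z, s34 y w x z, s12 w y z x, s12 x z w y, s12 y w x z]

include hB hBs hG hGs hGB in
theorem abstract_main {φ ξ : F → E} {lam : F → ℝ} (hφ : ContDiff ℝ ∞ φ) (hξ : ContDiff ℝ ∞ ξ)
    (hlam : ContDiff ℝ ∞ lam) (e : Fin 2 → F)
    (hxx : ∀ u, G (φ u) (ξ u) (ξ u) = 1)
    (hxX : ∀ u a, G (φ u) (ξ u) (fderiv ℝ φ u (e a)) = 0)
    (hspan : ∀ u w, (∀ a, G (φ u) w (fderiv ℝ φ u (e a)) = 0) → G (φ u) w (ξ u) = 0 → w = 0)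
    (humb : ∀ u a b, G (φ u) (acd B φ (fun q => fderiv ℝ φ q (e b)) (e a) u) (ξ u)
      = lam u * G (φ u) (fderiv ℝ φ u (e a)) (fderiv ℝ φ u (e b)))
    (I : F → Fin 2 → Fin 2 → ℝ) (C : F → Fin 2 → Fin 2 → Fin 2 → ℝ)
    (hI1 : ∀ u a c, ∑ b, I u a b * G (φ u) (fderiv ℝ φ u (e b)) (fderiv ℝ φ u (e c))
      = if a = c then 1 else 0)
    (hI2 : ∀ u b c, ∑ a, I u a b * G (φ u) (fderiv ℝ φ u (e a)) (fderiv ℝ φ u (e c))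
      = if b = c then 1 else 0)
    (hC : ∀ u a b d, ∑ c, C u c a b * G (φ u) (fderiv ℝ φ u (e c)) (fderiv ℝ φ u (e d))
      = G (φ u) (acd B φ (fun q => fderiv ℝ φ q (e b)) (e a) u) (fderiv ℝ φ u (e d)))
    (T : F → E)
    (hT : ∀ u, T u = ∑ a, ∑ b, I u a b • (acd B φ (fun q => fderiv ℝ φ q (e b)) (e a) u
      - ∑ c, C u c a b • fderiv ℝ φ u (e c)))
    (hbi : ∀ u, ∑ a, ∑ b, I u a b • (acd B φ (acd B φ T (e b)) (e a) u
        - ∑ c, C u c a b • acd B φ T (e c) u)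
      - ∑ a, ∑ b, I u a b • aR B (φ u) (fderiv ℝ φ u (e a)) (T u) (fderiv ℝ φ u (e b)) = 0) :
    ∀ u d, lam u * fderiv ℝ lam u (e d) = 0 := by
  have hX : ∀ a, ContDiff ℝ ∞ (fun q => fderiv ℝ φ q (e a)) := fun a => smooth_fderiv_apply hφ _
  have hxD : ∀ u a, acd B φ ξ (e a) u = -(lam u) • fderiv ℝ φ u (e a) := by
    intro u a
    rw [← sub_eq_zero]
    apply hspan u
    · intro b
      have h1 := acd_compat hG hGB hφ hξ (hX b) (e a) u
      simp only [hxX] at h1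
      have h2 := humb u a b
      rw [hGs] at h2
      rw [h2] at h1
      simp at h1 ⊢
      linarith
    · have h1 := acd_compat hG hGB hφ hξ hξ (e a) u
      simp only [hxx] at h1
      rw [hGs _ (ξ u)] at h1
      have h2 := hxX u a
      rw [hGs] at h2
      simp at h1 ⊢
      rw [h2]
      linarith
  have hTl : ∀ u, T u = (2 * lam u) • ξ u := by
    intro u
    rw [← sub_eq_zero]
    apply hspan u
    · intro d
      rw [hT]
      simp only [map_sub, map_sum, map_smul, sub_apply, sum_apply, smul_apply, smul_eq_mul, hC, hxX]
      simp
    · rw [hT]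
      have h2 : ∀ c, G (φ u) (fderiv ℝ φ u (e c)) (ξ u) = 0 := fun c => by rw [hGs, hxX]
      simp only [map_sub, map_sum, map_smul, sub_apply, sum_apply, smul_apply, smul_eq_mul, humb, hxx, h2]
      have i0 := hI2 u 0 0
      have i1 := hI2 u 1 1
      simp [Fin.sum_univ_two] at i0 i1 ⊢
      linear_combination lam u * i0 + lam u * i1
  have hTf : T = fun u => (2 * lam u) • ξ u := funext hTl
  have h2l : ContDiff ℝ ∞ (fun u => 2 * lam u) := contDiff_const.mul hlam
  have hDT : ∀ b, acd B φ T (e b) = fun u => (2 * fderiv ℝ lam u (e b)) • ξ u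
      + (-(2 * lam u ^ 2)) • fderiv ℝ φ u (e b) := by
    intro b
    ext u
    rw [hTf, acd_smul h2l hξ, hxD, fderiv_const_mul (hlam.dAt u)]
    simp [smul_smul]
    module
  intro u d
  have hlb : ∀ b, ContDiff ℝ ∞ (fun u => 2 * fderiv ℝ lam u (e b)) :=
    fun b => contDiff_const.mul (smooth_fderiv_apply hlam _)
  have hl2 : ContDiff ℝ ∞ (fun u => -(2 * lam u ^ 2)) := (contDiff_const.mul (hlam.pow 2)).neg
  have hl2d : ∀ a, fderiv ℝ (fun u => -(2 * lam u ^ 2)) u (e a)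
      = -(4 * lam u * fderiv ℝ lam u (e a)) := by
    intro a
    have := (((hlam.dAt u).hasFDerivAt.pow 2).const_mul 2).neg
    rw [HasFDerivAt.fderiv (f := fun u => -(2 * lam u ^ 2)) this]
    simp
    ring
  have hDDT : ∀ a b, G (φ u) (acd B φ (acd B φ T (e b)) (e a) u) (fderiv ℝ φ u (e d)) =
      -(2 * lam u * fderiv ℝ lam u (e b)) * G (φ u) (fderiv ℝ φ u (e a)) (fderiv ℝ φ u (e d))
      - (4 * lam u * fderiv ℝ lam u (e a)) * G (φ u) (fderiv ℝ φ u (e b)) (fderiv ℝ φ u (e d))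
      - 2 * lam u ^ 2 * G (φ u) (acd B φ (fun q => fderiv ℝ φ q (e b)) (e a) u)
          (fderiv ℝ φ u (e d)) := by
    intro a b
    have s1 : ContDiff ℝ ∞ (fun q => (2 * fderiv ℝ lam q (e b)) • ξ q) := (hlb b).smul hξ
    have s2 : ContDiff ℝ ∞ (fun q => (-(2 * lam q ^ 2)) • fderiv ℝ φ q (e b)) := hl2.smul (hX b)
    rw [hDT, acd_add s1 s2, acd_smul (hlb b) hξ,
      acd_smul hl2 (hX b), hl2d, hxD]
    simp only [map_add, map_smul, add_apply, smul_apply, smul_eq_mul, hxX]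
    ring
  have hDTX : ∀ c, G (φ u) (acd B φ T (e c) u) (fderiv ℝ φ u (e d)) =
      -(2 * lam u ^ 2) * G (φ u) (fderiv ℝ φ u (e c)) (fderiv ℝ φ u (e d)) := by
    intro c
    rw [hDT]
    simp only [map_add, map_smul, add_apply, smul_apply, smul_eq_mul, hxX]
    ring
  have hRx : ∀ b c, aR B (φ u) (fderiv ℝ φ u (e b)) (fderiv ℝ φ u (e c)) (ξ u)
      = -(fderiv ℝ lam u (e b)) • fderiv ℝ φ u (e c)
        + (fderiv ℝ lam u (e c)) • fderiv ℝ φ u (e b) := by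
    intro b c
    have hf : ∀ a, acd B φ ξ (e a) = fun u => (-(lam u)) • fderiv ℝ φ u (e a) :=
      fun a => funext fun u => hxD u a
    rw [← acd_acd hB hφ hξ, hf, hf, acd_smul hlam.neg (hX c), acd_smul hlam.neg (hX b),
      acd_torsion hBs hφ (e b) (e c), fderiv_fun_neg]
    simp
  have hR : ∀ a b, G (φ u) (aR B (φ u) (fderiv ℝ φ u (e a)) (T u) (fderiv ℝ φ u (e b)))
      (fderiv ℝ φ u (e d)) = 2 * lam u *
      (fderiv ℝ lam u (e b) * G (φ u) (fderiv ℝ φ u (e d)) (fderiv ℝ φ u (e a))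
       - fderiv ℝ lam u (e d) * G (φ u) (fderiv ℝ φ u (e b)) (fderiv ℝ φ u (e a))) := by
    intro a b
    rw [aR_pair hB hBs hG hGs hGB, aR_skew34 hB hG hGB, hTl]
    have := hRx b d
    have h2 : G (φ u) (fderiv ℝ φ u (e a)) (aR B (φ u) (fderiv ℝ φ u (e b))
        (fderiv ℝ φ u (e d)) ((2 * lam u) • ξ u)) = 2 * lam u *
        G (φ u) (fderiv ℝ φ u (e a)) (aR B (φ u) (fderiv ℝ φ u (e b))
        (fderiv ℝ φ u (e d)) (ξ u)) := by
      simp [aR]; ring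
    rw [h2, this, hGs]
    simp
    ring
  have key := congrArg (fun t => G (φ u) t (fderiv ℝ φ u (e d))) (hbi u)
  simp only [map_sub, map_sum, map_smul, sub_apply, sum_apply, smul_apply,
    smul_eq_mul, hDDT, hDTX, hR, map_zero, zero_apply] at key
  have hC' : ∀ a b, ∑ c, C u c a b * (-(2 * lam u ^ 2) * G (φ u) (fderiv ℝ φ u (e c))
      (fderiv ℝ φ u (e d))) = -(2 * lam u ^ 2) *
      G (φ u) (acd B φ (fun q => fderiv ℝ φ q (e b)) (e a) u) (fderiv ℝ φ u (e d)) := by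
    intro a b
    rw [← hC, Finset.mul_sum]
    exact Finset.sum_congr rfl fun _ _ => by ring
  simp only [hC'] at key
  have s := hGs (φ u) (fderiv ℝ φ u (e 0)) (fderiv ℝ φ u (e 1))
  have p0 := hI1 u 0 d
  have p1 := hI1 u 1 d
  have q0 := hI2 u 0 d
  have q1 := hI2 u 1 d
  have i0 := hI1 u 0 0
  have i1 := hI1 u 1 1
  simp only [hGs _ (fderiv ℝ φ u (e d))] at key
  simp only [Fin.sum_univ_two, Fin.isValue] at key p0 p1 q0 q1 i0 i1
  have hd : fderiv ℝ lam u (e 0) * ((if (0 : Fin 2) = d then (1:ℝ) else 0))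
      + fderiv ℝ lam u (e 1) * ((if (1 : Fin 2) = d then (1:ℝ) else 0)) = fderiv ℝ lam u (e d) := by
    fin_cases d <;> simp
  simp only [if_true] at i0 i1
  rw [← p0, ← p1] at hd
  have hd2 := hd
  rw [p0, p1, ← q0, ← q1] at hd2
  linear_combination (-1/4) * key - lam u * hd - lam u * hd2
    + (1/2) * lam u * fderiv ℝ lam u (e d) * (i0 + i1)
end Abstract

open scoped ContDiff

theorem smooth_smul_const {E F : Type*} [NormedAddCommGroup E] [NormedSpace ℝ E]
    [NormedAddCommGroup F] [NormedSpace ℝ F] {f : F → ℝ} (hf : ContDiff ℝ ∞ f) (c : E) :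
    ContDiff ℝ ∞ (fun x => f x • c) := hf.smul contDiff_const

/-- metric as bilinear form -/
def GG {n : ℕ} (g : Met n) (p : Pt n) : Pt n →L[ℝ] Pt n →L[ℝ] ℝ :=
  ∑ i, ∑ j, g p i j • (ContinuousLinearMap.proj (R := ℝ) (φ := fun _ : Fin n => ℝ) i).smulRight
    (ContinuousLinearMap.proj (R := ℝ) (φ := fun _ : Fin n => ℝ) j)

theorem GG_apply {n : ℕ} (g : Met n) (p v w : Pt n) : GG g p v w = gip g p v w := by
  simp [GG, gip, sum_apply, mul_assoc]

/-- Christoffel symbols as bilinear map -/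
def BB {n : ℕ} (g : Met n) (p : Pt n) : Pt n →L[ℝ] Pt n →L[ℝ] Pt n :=
  ∑ k, ∑ i, ∑ j, christoffel g p k i j •
    (ContinuousLinearMap.proj (R := ℝ) (φ := fun _ : Fin n => ℝ) i).smulRight
    ((ContinuousLinearMap.proj (R := ℝ) (φ := fun _ : Fin n => ℝ) j).smulRight
      (Pi.single k 1 : Pt n))

theorem BB_apply {n : ℕ} (g : Met n) (p v w : Pt n) (k : Fin n) :
    BB g p v w k = ∑ i, ∑ j, christoffel g p k i j * v i * w j := by
  simp only [BB, sum_apply, smul_apply, Finset.sum_apply, ContinuousLinearMap.smulRight_apply,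
    Pi.smul_apply, smul_eq_mul, Pi.single_apply, ContinuousLinearMap.proj_apply]
  rw [Finset.sum_eq_single k]
  · simp [mul_assoc]
  · intro b _ hb
    simp [hb.symm]
  · simp

theorem isUnit_det_of_pos {n : ℕ} {M : Matrix (Fin n) (Fin n) ℝ}
    (h : ∀ v : Pt n, v ≠ 0 → 0 < ∑ i, ∑ j, M i j * v i * v j) : IsUnit M.det := by
  rw [isUnit_iff_ne_zero]
  intro h0
  obtain ⟨v, hv, hv0⟩ := Matrix.exists_mulVec_eq_zero_iff.2 h0
  have := h v hv
  have e : ∑ i, ∑ j, M i j * v i * v j = ∑ i, v i * (M.mulVec v) i := by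
    simp only [Matrix.mulVec, dotProduct, Finset.mul_sum]
    exact Finset.sum_congr rfl fun _ _ => Finset.sum_congr rfl fun _ _ => by ring
  rw [e, hv0] at this
  simp at this

theorem smooth_det {n m : ℕ} {M : Pt m → Matrix (Fin n) (Fin n) ℝ}
    (h : ∀ i j, ContDiff ℝ ∞ (fun p => M p i j)) : ContDiff ℝ ∞ (fun p => (M p).det) := by
  simp only [Matrix.det_apply']
  exact ContDiff.sum fun σ _ => contDiff_const.mul (contDiff_prod fun i _ => h _ _)

theorem smooth_inv {n m : ℕ} {M : Pt m → Matrix (Fin n) (Fin n) ℝ}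
    (h : ∀ i j, ContDiff ℝ ∞ (fun p => M p i j)) (hu : ∀ p, IsUnit (M p).det) (i j : Fin n) :
    ContDiff ℝ ∞ (fun p => (M p)⁻¹ i j) := by
  simp only [Matrix.inv_def, Matrix.smul_apply, Ring.inverse_eq_inv', smul_eq_mul,
    Matrix.adjugate_apply]
  refine ((smooth_det h).inv fun p => (hu p).ne_zero).mul (smooth_det fun a b => ?_)
  simp only [Matrix.updateRow_apply]
  split_ifs
  · exact contDiff_const
  · exact h a b

theorem smooth_christoffel {n : ℕ} {g : Met n} (h : ∀ i j, ContDiff ℝ ∞ (fun p => g p i j))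
    (hu : ∀ p, IsUnit (g p).det) (k i j : Fin n) :
    ContDiff ℝ ∞ (fun p => christoffel g p k i j) := by
  unfold christoffel
  refine contDiff_const.mul (ContDiff.sum fun l _ => (smooth_inv h hu _ _).mul ?_)
  exact ((smooth_fderiv_apply (h _ _) _).add (smooth_fderiv_apply (h _ _) _)).sub
    (smooth_fderiv_apply (h _ _) _)

theorem christoffel_lower {n : ℕ} {g : Met n} (hs : ∀ p i j, g p i j = g p j i)
    (hu : ∀ p, IsUnit (g p).det) (p : Pt n) (i j l : Fin n) :
    ∑ k, christoffel g p k i j * g p k l = (1 / 2) *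
    (fderiv ℝ (fun q => g q j l) p (Pi.single i 1)
      + fderiv ℝ (fun q => g q i l) p (Pi.single j 1)
      - fderiv ℝ (fun q => g q i j) p (Pi.single l 1)) := by
  have h1 : ∀ m, ∑ k, g p l k * (g p)⁻¹ k m = if l = m then 1 else 0 := by
    intro m
    rw [← Matrix.mul_apply, Matrix.mul_nonsing_inv _ (hu p), Matrix.one_apply]
  simp only [christoffel, Finset.mul_sum, Finset.sum_mul]
  rw [Finset.sum_comm]
  have h2 : ∀ m, ∑ k, 1 / 2 * ((g p)⁻¹ k m * (fderiv ℝ (fun q => g q j m) p (Pi.single i 1)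
      + fderiv ℝ (fun q => g q i m) p (Pi.single j 1)
      - fderiv ℝ (fun q => g q i j) p (Pi.single m 1))) * g p k l =
      (if l = m then 1 else 0) * ((1 / 2) * (fderiv ℝ (fun q => g q j m) p (Pi.single i 1)
      + fderiv ℝ (fun q => g q i m) p (Pi.single j 1)
      - fderiv ℝ (fun q => g q i j) p (Pi.single m 1))) := by
    intro m
    rw [← h1, Finset.sum_mul]
    refine Finset.sum_congr rfl fun k _ => ?_
    rw [hs p k l]
    ring
  simp only [h2]
  simp

theorem christoffel_symm {n : ℕ} {g : Met n} (hs : ∀ p i j, g p i j = g p j i)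
    (p : Pt n) (k i j : Fin n) : christoffel g p k i j = christoffel g p k j i := by
  unfold christoffel
  congr 1
  refine Finset.sum_congr rfl fun l _ => ?_
  simp_rw [hs _ i j]
  ring

theorem BB_symm {n : ℕ} {g : Met n} (hs : ∀ p i j, g p i j = g p j i)
    (p x y : Pt n) : BB g p x y = BB g p y x := by
  ext k
  rw [BB_apply, BB_apply, Finset.sum_comm]
  refine Finset.sum_congr rfl fun i _ => Finset.sum_congr rfl fun j _ => ?_
  rw [christoffel_symm hs]
  ring

theorem GG_symm {n : ℕ} {g : Met n} (hs : ∀ p i j, g p i j = g p j i)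
    (p x y : Pt n) : GG g p x y = GG g p y x := by
  rw [GG_apply, GG_apply, gip, gip, Finset.sum_comm]
  refine Finset.sum_congr rfl fun i _ => Finset.sum_congr rfl fun j _ => ?_
  rw [hs]
  ring

theorem smooth_GG {n : ℕ} {g : Met n} (h : ∀ i j, ContDiff ℝ ∞ (fun p => g p i j)) :
    ContDiff ℝ ∞ (GG g) := by
  unfold GG
  exact ContDiff.sum fun i _ => ContDiff.sum fun j _ => smooth_smul_const (h i j) _

theorem smooth_BB {n : ℕ} {g : Met n} (h : ∀ i j, ContDiff ℝ ∞ (fun p => g p i j))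
    (hu : ∀ p, IsUnit (g p).det) : ContDiff ℝ ∞ (BB g) := by
  unfold BB
  exact ContDiff.sum fun k _ => ContDiff.sum fun i _ => ContDiff.sum fun j _ =>
    smooth_smul_const (smooth_christoffel h hu k i j) _

theorem gip_BB (g : Met 3) (p x v w : Pt 3) : GG g p (BB g p x v) w =
    ∑ l, ∑ i, ∑ j, (∑ k, christoffel g p k l i * g p k j) * x l * v i * w j := by
  rw [GG_apply, gip]
  simp only [BB_apply, Fin.sum_univ_three]
  ring

theorem GG_compat {g : Met 3} (hs : ∀ p i j, g p i j = g p j i)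
    (h : ∀ i j, ContDiff ℝ ∞ (fun p => g p i j))
    (hu : ∀ p, IsUnit (g p).det) (p x v w : Pt 3) :
    fderiv ℝ (GG g) p x v w = GG g p (BB g p x v) w + GG g p v (BB g p x w) := by
  have h0 : fderiv ℝ (GG g) p x v w = fderiv ℝ (fun q => GG g q v w) p x := by
    have := fderiv2 (smooth_GG h) (F := Pt 3) contDiff_id (contDiff_const (c := v))
      (contDiff_const (c := w)) x p
    simpa using this.symm
  have h1 : ∀ i j, fderiv ℝ (fun q => g q i j) p x
      = ∑ l, fderiv ℝ (fun q => g q i j) p (Pi.single l 1) * x l := by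
    intro i j
    conv_lhs => rw [pi_eq_sum_univ' x]
    rw [map_sum]
    refine Finset.sum_congr rfl fun l _ => ?_
    rw [map_smul, smul_eq_mul, mul_comm]
  have h2 : fderiv ℝ (fun q => GG g q v w) p x =
      ∑ i, ∑ j, fderiv ℝ (fun q => g q i j) p x * v i * w j := by
    simp only [GG_apply, gip]
    have h3 : HasFDerivAt (fun q => ∑ i, ∑ j, g q i j * v i * w j)
        (∑ i, ∑ j, w j • v i • fderiv ℝ (fun q => g q i j) p) p :=
      HasFDerivAt.fun_sum fun i _ => HasFDerivAt.fun_sum fun j _ =>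
        (((h i j).dAt p).hasFDerivAt.mul_const (v i)).mul_const (w j)
    rw [h3.fderiv]
    simp only [sum_apply, smul_apply, smul_eq_mul]
    exact Finset.sum_congr rfl fun i _ => Finset.sum_congr rfl fun j _ => by ring
  rw [GG_symm hs p v, gip_BB, gip_BB, h0, h2]
  simp only [h1, christoffel_lower hs hu]
  have s01 : (fun q => g q 1 0) = (fun q => g q 0 1) := funext fun q => hs q 1 0
  have s02 : (fun q => g q 2 0) = (fun q => g q 0 2) := funext fun q => hs q 2 0
  have s12 : (fun q => g q 2 1) = (fun q => g q 1 2) := funext fun q => hs q 2 1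
  simp only [Fin.sum_univ_three, s01, s02, s12]
  ring

theorem fderiv_coord {m n : ℕ} {V : Pt m → Pt n} (hV : ContDiff ℝ ∞ V) (u e : Pt m) (k : Fin n) :
    fderiv ℝ (fun q => V q k) u e = fderiv ℝ V u e k := by
  have := hasFDerivAt_pi'.1 (hV.dAt u).hasFDerivAt k
  rw [this.fderiv]
  rfl

theorem dmap_eq {m n : ℕ} {V : Pt m → Pt n} (hV : ContDiff ℝ ∞ V) (u : Pt m) (a : Fin m) :
    dmap V u a = fderiv ℝ V u (Pi.single a 1) := by
  ext k
  exact fderiv_coord hV _ _ _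

theorem covAlong_eq {m n : ℕ} (g : Met n) {φ V : Pt m → Pt n} (hφ : ContDiff ℝ ∞ φ)
    (hV : ContDiff ℝ ∞ V) (a : Fin m) :
    covAlong g φ V a = acd (BB g) φ V (Pi.single a 1) := by
  ext u k
  simp only [covAlong, acd, Pi.add_apply, BB_apply, fderiv_coord hV, dmap_eq hφ]

theorem cov_eq {n : ℕ} (g : Met n) {V : Pt n → Pt n} (hV : ContDiff ℝ ∞ V) (v : Pt n) :
    cov g (fun _ => v) V = acd (BB g) (fun q => q) V v := by
  ext u k
  simp only [cov, acd, Pi.add_apply, BB_apply, fderiv_coord hV, fderiv_fun_id,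
    ContinuousLinearMap.id_apply]

theorem curvPt_eq {n : ℕ} {g : Met n} (hB : ContDiff ℝ ∞ (BB g)) (p v w z : Pt n) :
    curvPt g p v w z = aR (BB g) p v w z := by
  have hid : ContDiff ℝ ∞ (fun q : Pt n => q) := contDiff_id
  have hz : ContDiff ℝ ∞ (fun _ : Pt n => z) := contDiff_const
  have c1 := acd_acd hB hid hz v w p
  simp only [fderiv_fun_id, ContinuousLinearMap.id_apply] at c1
  rw [← c1, curvPt, curvOp, cov_eq g hz, cov_eq g hz, cov_eq g (smooth_acd hB hid hz _),
    cov_eq g (smooth_acd hB hid hz _)]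
  have : cov g (lieB (fun _ => v) fun _ => w) (fun _ => z) p = 0 := by
    ext k
    simp [cov, lieB]
  rw [this, sub_zero]

/-- Theorem 3.1. A totally umbilical biharmonic surface in any
3-dimensional Riemannian manifold has constant mean curvature. -/
theorem totally_umbilical_biharmonic_surface_has_cmc
    (g : Met 3) (hg : IsRiemannian g) (φ ξ : Pt 2 → Pt 3)
    (hφ : IsImmersion φ) (hξ : IsUnitNormal g φ ξ)
    (humb : IsTotallyUmbilical g φ ξ) (hbh : IsBiharmonic g φ) :
    ∃ c : ℝ, ∀ u, meanCurv g φ ξ u = c := by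
  obtain ⟨lam, hlam⟩ := humb
  have sg : ∀ i j, ContDiff ℝ ∞ (fun p => g p i j) := hg.smooth
  have ug : ∀ p, IsUnit (g p).det := fun p => isUnit_det_of_pos (hg.posdef p)
  have sφ : ContDiff ℝ ∞ φ := contDiff_pi.2 hφ.1
  have sξ : ContDiff ℝ ∞ ξ := contDiff_pi.2 hξ.1
  have hB := smooth_BB sg ug
  have hG := smooth_GG sg
  have hBs := BB_symm hg.symm
  have hGs := GG_symm hg.symm
  have hGB := GG_compat hg.symm sg ug
  let e : Fin 2 → Pt 2 := fun a => Pi.single a 1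
  have sX : ∀ a, ContDiff ℝ ∞ (fun q => fderiv ℝ φ q (e a)) := fun a => smooth_fderiv_apply sφ _
  have sD : ∀ a b, ContDiff ℝ ∞ (acd (BB g) φ (fun q => fderiv ℝ φ q (e b)) (e a)) :=
    fun a b => smooth_acd hB sφ (sX b) _
  have eX : ∀ u a, dmap φ u a = fderiv ℝ φ u (e a) := fun u a => dmap_eq sφ u a
  have eXf : ∀ a, (fun q => dmap φ q a) = fun q => fderiv ℝ φ q (e a) :=
    fun a => funext fun u => eX u a
  have efff : ∀ u a b, fff g φ u a b
      = GG g (φ u) (fderiv ℝ φ u (e a)) (fderiv ℝ φ u (e b)) := by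
    intro u a b
    rw [fff, Matrix.of_apply, GG_apply, eX, eX]
  have eD : ∀ u a b, (fun k => fderiv ℝ (fun q => dmap φ q b k) u (Pi.single a 1)
      + ∑ i, ∑ j, christoffel g (φ u) k i j * dmap φ u a i * dmap φ u b j)
      = acd (BB g) φ (fun q => fderiv ℝ φ q (e b)) (e a) u := by
    intro u a b
    have := congrFun (covAlong_eq g sφ (sX b) a) u
    rw [← this]
    ext k
    simp only [covAlong, eX]
  have esff : ∀ u a b, sff g φ ξ u a b
      = GG g (φ u) (acd (BB g) φ (fun q => fderiv ℝ φ q (e b)) (e a) u) (ξ u) := by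
    intro u a b
    rw [sff, eD, GG_apply]
  have sGG : ∀ {V W : Pt 2 → Pt 3}, ContDiff ℝ ∞ V → ContDiff ℝ ∞ W →
      ContDiff ℝ ∞ (fun u => GG g (φ u) (V u) (W u)) := fun hV hW =>
    ((hG.comp sφ).clm_apply hV).clm_apply hW
  have sf : ∀ a b, ContDiff ℝ ∞ (fun u => fff g φ u a b) := by
    intro a b
    simp only [efff]
    exact sGG (sX a) (sX b)
  have fs : ∀ u a b, fff g φ u a b = fff g φ u b a := by
    intro u a b
    rw [efff, efff, hGs]
  have li : ∀ u, LinearIndependent ℝ (fun a => fderiv ℝ φ u (e a)) := by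
    intro u
    have := hφ.2 u
    rwa [show dmap φ u = fun a => fderiv ℝ φ u (e a) from funext fun a => eX u a] at this
  have hpos : ∀ p v, v ≠ 0 → 0 < GG g p v v := fun p v hv => by
    rw [GG_apply]; exact hg.posdef p v hv
  have uf : ∀ u, IsUnit (fff g φ u).det := by
    intro u
    apply isUnit_det_of_pos
    intro v hv
    have hne : ∑ a, v a • fderiv ℝ φ u (e a) ≠ 0 := by
      intro h0
      exact hv (funext (Fintype.linearIndependent_iff.1 (li u) v h0))
    have := hpos (φ u) _ hne
    simp only [map_sum, map_smul, sum_apply, smul_apply, smul_eq_mul] at this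
    refine this.trans_le (le_of_eq ?_)
    simp only [efff, Fin.sum_univ_two]
    ring
  have hxx : ∀ u, GG g (φ u) (ξ u) (ξ u) = 1 := fun u => by rw [GG_apply]; exact hξ.2.1 u
  have hxX : ∀ u a, GG g (φ u) (ξ u) (fderiv ℝ φ u (e a)) = 0 := fun u a => by
    rw [GG_apply, ← eX]; exact hξ.2.2 u a
  have hspan : ∀ u w, (∀ a, GG g (φ u) w (fderiv ℝ φ u (e a)) = 0) →
      GG g (φ u) w (ξ u) = 0 → w = 0 := by
    intro u w h1 h2
    have hl : LinearIndependent ℝ (Fin.cons (ξ u) (fun a => fderiv ℝ φ u (e a)) :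
        Fin 3 → Pt 3) := by
      rw [linearIndependent_finCons]
      refine ⟨li u, fun hm => ?_⟩
      have : Submodule.span ℝ (Set.range fun a => fderiv ℝ φ u (e a))
          ≤ LinearMap.ker (GG g (φ u) (ξ u)).toLinearMap := by
        rw [Submodule.span_le]
        rintro _ ⟨a, rfl⟩
        exact hxX u a
      have h3 : GG g (φ u) (ξ u) (ξ u) = 0 := this hm
      rw [hxx] at h3
      exact one_ne_zero h3
    have ht := hl.span_eq_top_of_card_eq_finrank' (by simp)
    have hle : Submodule.span ℝ (Set.range (Fin.cons (ξ u) (fun a => fderiv ℝ φ u (e a)) :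
        Fin 3 → Pt 3)) ≤ LinearMap.ker (GG g (φ u) w).toLinearMap := by
      rw [Submodule.span_le]
      rintro _ ⟨a, rfl⟩
      refine Fin.cases ?_ (fun a => ?_) a
      · exact h2
      · exact h1 a
    rw [ht] at hle
    have h3 : GG g (φ u) w w = 0 := hle (Submodule.mem_top (x := w))
    by_contra hw
    exact (hpos (φ u) w hw).ne' h3
  have humb' : ∀ u a b, GG g (φ u) (acd (BB g) φ (fun q => fderiv ℝ φ q (e b)) (e a) u) (ξ u)
      = lam u * GG g (φ u) (fderiv ℝ φ u (e a)) (fderiv ℝ φ u (e b)) := by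
    intro u a b
    rw [← esff, ← efff, hlam]
  have hf0 : ∀ u, fff g φ u 0 0 ≠ 0 := by
    intro u
    rw [efff]
    exact (hpos _ _ ((li u).ne_zero 0)).ne'
  have slam : ContDiff ℝ ∞ lam := by
    have : lam = fun u => sff g φ ξ u 0 0 / fff g φ u 0 0 := by
      ext u
      rw [hlam, mul_div_cancel_right₀ _ (hf0 u)]
    rw [this]
    refine ContDiff.div ?_ (sf 0 0) hf0
    simp only [esff]
    exact sGG (sD 0 0) sξ
  have hI1 : ∀ u a c, ∑ b, (fff g φ u)⁻¹ a b *
      GG g (φ u) (fderiv ℝ φ u (e b)) (fderiv ℝ φ u (e c)) = if a = c then 1 else 0 := by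
    intro u a c
    simp only [← efff]
    rw [← Matrix.mul_apply, Matrix.nonsing_inv_mul _ (uf u), Matrix.one_apply]
  have hI2 : ∀ u b c, ∑ a, (fff g φ u)⁻¹ a b *
      GG g (φ u) (fderiv ℝ φ u (e a)) (fderiv ℝ φ u (e c)) = if b = c then 1 else 0 := by
    intro u b c
    simp only [← efff, fs u _ c]
    simp only [mul_comm ((fff g φ u)⁻¹ _ _)]
    rw [← Matrix.mul_apply, Matrix.mul_nonsing_inv _ (uf u), Matrix.one_apply]
    simp [eq_comm]
  have hC : ∀ u a b d, ∑ c, christoffel (fff g φ) u c a b *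
      GG g (φ u) (fderiv ℝ φ u (e c)) (fderiv ℝ φ u (e d))
      = GG g (φ u) (acd (BB g) φ (fun q => fderiv ℝ φ q (e b)) (e a) u)
        (fderiv ℝ φ u (e d)) := by
    intro u a b d
    simp only [← efff]
    rw [christoffel_lower fs uf]
    simp only [efff]
    have c1 := acd_compat hG hGB sφ (sX b) (sX d) (e a) u
    have c2 := acd_compat hG hGB sφ (sX a) (sX d) (e b) u
    have c3 := acd_compat hG hGB sφ (sX a) (sX b) (e d) u
    have t1 := acd_torsion hBs sφ (e a) (e b) u
    have t2 := acd_torsion hBs sφ (e a) (e d) u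
    have t3 := acd_torsion hBs sφ (e b) (e d) u
    rw [← t1, t3] at c2
    rw [t2] at c1
    rw [hGs _ _ (fderiv ℝ φ u (e b))] at c3
    have c1' : fderiv ℝ (fun q => GG g (φ q) (fderiv ℝ φ q (e b)) (fderiv ℝ φ q (e d))) u
      (Pi.single a 1) = _ := c1
    have c2' : fderiv ℝ (fun q => GG g (φ q) (fderiv ℝ φ q (e a)) (fderiv ℝ φ q (e d))) u
      (Pi.single b 1) = _ := c2
    have c3' : fderiv ℝ (fun q => GG g (φ q) (fderiv ℝ φ q (e a)) (fderiv ℝ φ q (e b))) u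
      (Pi.single d 1) = _ := c3
    rw [c1', c2', c3']
    ring
  have hT : ∀ u, tension g φ u = ∑ a, ∑ b, (fff g φ u)⁻¹ a b •
      (acd (BB g) φ (fun q => fderiv ℝ φ q (e b)) (e a) u
      - ∑ c, christoffel (fff g φ) u c a b • fderiv ℝ φ u (e c)) := by
    intro u
    ext k
    simp only [tension, Finset.sum_apply, Pi.smul_apply, Pi.sub_apply, smul_eq_mul, ← eD]
    simp only [eX]
    exact Finset.sum_congr rfl fun a _ => Finset.sum_congr rfl fun b _ => by ring
  have sT : ContDiff ℝ ∞ (tension g φ) := by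
    rw [funext hT]
    refine ContDiff.sum fun a _ => ContDiff.sum fun b _ => (smooth_inv sf uf a b).smul
      ((sD a b).sub (ContDiff.sum fun c _ => (smooth_christoffel sf uf c a b).smul (sX c)))
  have hbi : ∀ u, ∑ a, ∑ b, (fff g φ u)⁻¹ a b •
        (acd (BB g) φ (acd (BB g) φ (tension g φ) (e b)) (e a) u
        - ∑ c, christoffel (fff g φ) u c a b • acd (BB g) φ (tension g φ) (e c) u)
      - ∑ a, ∑ b, (fff g φ u)⁻¹ a b • aR (BB g) (φ u) (fderiv ℝ φ u (e a)) (tension g φ u)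
          (fderiv ℝ φ u (e b)) = 0 := by
    intro u
    rw [← hbh u]
    ext k
    simp only [bitension, covAlong_eq g sφ sT,
      covAlong_eq g sφ (smooth_acd hB sφ sT _), curvPt_eq hB, eX]
    simp only [Finset.sum_apply, Pi.smul_apply, Pi.sub_apply, smul_eq_mul]
    rfl
  have main := abstract_main hB hBs hG hGs hGB sφ sξ slam e hxx hxX hspan humb'
    (fun u a b => (fff g φ u)⁻¹ a b) (fun u c a b => christoffel (fff g φ) u c a b)
    hI1 hI2 hC (tension g φ) hT hbi
  have hsq : ∀ u, fderiv ℝ (fun q => lam q ^ 2) u = 0 := by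
    intro u
    have h1 : HasFDerivAt (fun q => lam q ^ 2) _ u := (slam.dAt u).hasFDerivAt.pow 2
    rw [h1.fderiv]
    ext v
    have h0 := main u 0
    have h1 := main u 1
    have hv : v = v 0 • e 0 + v 1 • e 1 := by
      ext i
      fin_cases i <;> simp [e]
    rw [hv]
    simp only [map_add, map_smul, smul_apply, smul_eq_mul, zero_apply]
    simp
    linear_combination 2 * v 0 * h0 + 2 * v 1 * h1
  have hcst : ∀ u, lam u ^ 2 = lam 0 ^ 2 := fun u =>
    is_const_of_fderiv_eq_zero (𝕜 := ℝ) ((slam.pow 2).differentiable (by simp)) hsq u 0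
  have hlc : ∀ u, lam u = lam 0 := by
    by_cases h0 : lam 0 = 0
    · intro u
      have := hcst u
      rw [h0] at this ⊢
      simpa using this
    · intro u
      have hc := isPreconnected_univ (α := Pt 2) |>.eq_of_sq_eq (f := lam) (g := fun _ => lam 0)
        slam.continuous.continuousOn continuousOn_const (fun v _ => hcst v)
        (fun _ => h0) (Set.mem_univ 0) rfl
      exact hc (Set.mem_univ u)
  refine ⟨lam 0, fun u => ?_⟩
  rw [← hlc u]
  have i0 := hI1 u 0 0
  have i1 := hI1 u 1 1
  simp only [← efff] at i0 i1
  simp only [meanCurv, shapeOp, hlam]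
  simp [Fin.sum_univ_two] at i0 i1 ⊢
  linear_combination (1/2) * lam u * i0 + (1/2) * lam u * i1
end
end

section
/- A totally umbilical surface in the Sol space (ℝ³, g_Sol = e^{2z}dx² + e^{-2z}dy² + dz²) is biharmonic if and only if it is minimal. -/
/-!
Coordinate-based Riemannian geometry on charts `ℝⁿ`, enough to express mean
curvature, second fundamental forms, curvature tensors and the (bi)tension
fields of isometric immersions, as used in
"Constant mean curvature and totally umbilical biharmonic surfaces in
3-dimensional geometries".
-/

noncomputable section

open scoped BigOperators

namespace SolAux

def pd {m : ℕ} (a : Fin m) (f : Pt m → ℝ) (u : Pt m) : ℝ := fderiv ℝ f u (Pi.single a 1)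

def Sm {m n : ℕ} (V : Pt m → Pt n) : Prop := ∀ k, ContDiff ℝ (⊤ : ℕ∞) fun u => V u k

def gam (p v w : Pt 3) : Pt 3 :=
  ![v 0 * w 2 + v 2 * w 0, -(v 1 * w 2) - v 2 * w 1,
    -(Real.exp (2 * p 2) * (v 0 * w 0)) + Real.exp (-(2 * p 2)) * (v 1 * w 1)]

lemma gip_sol (p v w : Pt 3) : gip solMet p v w =
    Real.exp (2 * p 2) * (v 0 * w 0) + Real.exp (-(2 * p 2)) * (v 1 * w 1) + v 2 * w 2 := by
  simp [gip, solMet, Fin.sum_univ_three]; ring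

lemma sol_inv (p : Pt 3) : (solMet p)⁻¹ =
    Matrix.diagonal ![Real.exp (-(2 * p 2)), Real.exp (2 * p 2), 1] := by
  apply Matrix.inv_eq_right_inv
  ext i j
  fin_cases i <;> fin_cases j <;>
    simp [solMet, Matrix.mul_apply, ← Real.exp_add]

lemma fd_E (p v : Pt 3) : fderiv ℝ (fun q : Pt 3 => Real.exp (2 * q 2)) p v
    = 2 * Real.exp (2 * p 2) * v 2 := by
  have h : HasFDerivAt (fun q : Pt 3 => q 2) (ContinuousLinearMap.proj 2) p :=
    (ContinuousLinearMap.proj (R := ℝ) (φ := fun _ : Fin 3 => ℝ) 2).hasFDerivAt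
  rw [((h.const_mul 2).exp).fderiv]
  simp; ring

lemma fd_F (p v : Pt 3) : fderiv ℝ (fun q : Pt 3 => Real.exp (-(2 * q 2))) p v
    = -2 * Real.exp (-(2 * p 2)) * v 2 := by
  have h : HasFDerivAt (fun q : Pt 3 => q 2) (ContinuousLinearMap.proj 2) p :=
    (ContinuousLinearMap.proj (R := ℝ) (φ := fun _ : Fin 3 => ℝ) 2).hasFDerivAt
  rw [(((h.const_mul 2).fun_neg).exp).fderiv]
  simp; ring

lemma fd_sol (p v : Pt 3) (i j : Fin 3) : fderiv ℝ (fun q => solMet q i j) p v =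
    (if i = j then
      if (i : ℕ) = 0 then 2 * Real.exp (2 * p 2)
      else if (i : ℕ) = 1 then -2 * Real.exp (-(2 * p 2)) else 0
    else 0) * v 2 := by
  fin_cases i <;> fin_cases j <;> simp [solMet, fd_E, fd_F]

lemma EF (t : ℝ) : Real.exp t * Real.exp (-t) = 1 := by
  rw [← Real.exp_add]; simp

lemma gam_eq (p v w : Pt 3) (k : Fin 3) :
    ∑ i, ∑ j, christoffel solMet p k i j * v i * w j = gam p v w k := by
  have h := EF (2 * p 2)
  fin_cases k <;>
  simp [christoffel, sol_inv, fd_sol, Fin.sum_univ_three, gam, Matrix.diagonal_apply, Pi.single_apply]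
  all_goals grind

lemma covAlong_sol (φ V : Pt 2 → Pt 3) (a : Fin 2) (u : Pt 2) (k : Fin 3) :
    covAlong solMet φ V a u k = pd a (fun q => V q k) u + gam (φ u) (dmap φ u a) (V u) k := by
  unfold covAlong; rw [gam_eq]; rfl

lemma cov_sol (X Y : VF 3) (p : Pt 3) (k : Fin 3) :
    cov solMet X Y p k = fderiv ℝ (fun q => Y q k) p (X p) + gam p (X p) (Y p) k := by
  unfold cov; rw [gam_eq]

/-- derivative of gam in the base point -/
def dgam (p x v w : Pt 3) : Pt 3 :=
  ![0, 0, (-2 * Real.exp (2 * p 2) * (v 0 * w 0) - 2 * Real.exp (-(2 * p 2)) * (v 1 * w 1)) * x 2]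

lemma fd_gam (p x v w : Pt 3) (k : Fin 3) :
    fderiv ℝ (fun q => gam q v w k) p x = dgam p x v w k := by
  fin_cases k
  · simp [gam, dgam]
  · simp [gam, dgam]
  · simp only [gam, dgam]
    have h1 : DifferentiableAt ℝ (fun q : Pt 3 => Real.exp (2 * q 2)) p := by fun_prop
    have h2 : DifferentiableAt ℝ (fun q : Pt 3 => Real.exp (-(2 * q 2))) p := by fun_prop
    have := ((h1.hasFDerivAt.mul_const (v 0 * w 0)).neg.add
      (h2.hasFDerivAt.mul_const (v 1 * w 1))).fderiv
    simp at this ⊢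
    erw [this]
    simp [fd_E, fd_F]; ring

lemma curvPt_sol (p v w z : Pt 3) (k : Fin 3) :
    curvPt solMet p v w z k = dgam p v w z k + gam p v (gam p w z) k
      - (dgam p w v z k + gam p w (gam p v z) k) := by
  have h : ∀ (a b : Pt 3), cov solMet (fun _ => a) (fun _ => b) = fun q => gam q a b := by
    intro a b; ext q k; rw [cov_sol]; simp
  have h0 : lieB (fun _ : Pt 3 => v) (fun _ => w) = fun _ => 0 := by
    ext q k; simp [lieB]
  unfold curvPt curvOp
  simp only [Pi.sub_apply, h, h0, cov_sol, fd_gam]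
  have : gam p 0 z k = 0 := by fin_cases k <;> simp [gam]
  simp [this]

section pdrules
variable {m : ℕ} {f g : Pt m → ℝ}

lemma Sm.diff {n : ℕ} {V : Pt m → Pt n} (h : Sm V) (k : Fin n) : Differentiable ℝ (fun u => V u k) :=
  (h k).differentiable (by simp)

lemma pd_contDiff (hf : ContDiff ℝ (⊤ : ℕ∞) f) (a : Fin m) : ContDiff ℝ (⊤ : ℕ∞) (pd a f) := by
  unfold pd
  exact (hf.fderiv_right (m := (⊤ : ℕ∞)) (by simp)).clm_apply contDiff_const

lemma pd_add (hf : Differentiable ℝ f) (hg : Differentiable ℝ g) (a : Fin m) (u : Pt m) :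
    pd a (fun q => f q + g q) u = pd a f u + pd a g u := by
  unfold pd; rw [fderiv_fun_add (hf u) (hg u)]; rfl

lemma pd_sub (hf : Differentiable ℝ f) (hg : Differentiable ℝ g) (a : Fin m) (u : Pt m) :
    pd a (fun q => f q - g q) u = pd a f u - pd a g u := by
  unfold pd; rw [fderiv_fun_sub (hf u) (hg u)]; rfl

lemma pd_neg (a : Fin m) (u : Pt m) :
    pd a (fun q => - f q) u = - pd a f u := by
  unfold pd; rw [fderiv_fun_neg]; rfl

lemma pd_mul (hf : Differentiable ℝ f) (hg : Differentiable ℝ g) (a : Fin m) (u : Pt m) :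
    pd a (fun q => f q * g q) u = pd a f u * g u + f u * pd a g u := by
  unfold pd; rw [fderiv_fun_mul (hf u) (hg u)]; simp; ring

lemma pd_const (c : ℝ) (a : Fin m) (u : Pt m) : pd a (fun _ => c) u = 0 := by
  unfold pd; simp

lemma pd_exp (hf : Differentiable ℝ f) (a : Fin m) (u : Pt m) :
    pd a (fun q => Real.exp (f q)) u = Real.exp (f u) * pd a f u := by
  unfold pd; rw [fderiv_exp (hf u)]; simp

lemma pd_comm (hf : ContDiff ℝ (⊤ : ℕ∞) f) (a b : Fin m) (u : Pt m) :
    pd a (pd b f) u = pd b (pd a f) u := by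
  have hs : IsSymmSndFDerivAt ℝ f u :=
    (hf.contDiffAt).isSymmSndFDerivAt (by simp only [minSmoothness_of_isRCLikeNormedField]; exact WithTop.coe_le_coe.2 (le_top : (2 : ℕ∞) ≤ ⊤))
  have hd : DifferentiableAt ℝ (fderiv ℝ f) u :=
    ((hf.fderiv_right (m := (⊤ : ℕ∞)) (by simp)).differentiable (by simp)) u
  have key : ∀ c d : Fin m, pd c (pd d f) u =
      fderiv ℝ (fderiv ℝ f) u (Pi.single c 1) (Pi.single d 1) := by
    intro c d
    unfold pd
    rw [fderiv_clm_apply hd (by fun_prop)]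
    simp
  rw [key, key]; exact hs _ _
end pdrules

lemma dmap_pd {m n : ℕ} (φ : Pt m → Pt n) (u : Pt m) (a : Fin m) (k : Fin n) :
    dmap φ u a k = pd a (fun q => φ q k) u := rfl

lemma Sm.dmap {m n : ℕ} {φ : Pt m → Pt n} (h : Sm φ) (a : Fin m) : Sm (fun q => dmap φ q a) :=
  fun k => pd_contDiff (h k) a

section along
variable {φ X V W : Pt 2 → Pt 3}

lemma pdE (hφ : Sm φ) (a : Fin 2) (u : Pt 2) :
    pd a (fun q => Real.exp (2 * φ q 2)) u = Real.exp (2 * φ u 2) * (2 * dmap φ u a 2) := by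
  have := hφ.diff 2
  rw [pd_exp (by fun_prop), pd_mul (by fun_prop) (by fun_prop), pd_const, dmap_pd]; ring

lemma pdF (hφ : Sm φ) (a : Fin 2) (u : Pt 2) :
    pd a (fun q => Real.exp (-(2 * φ q 2))) u =
      Real.exp (-(2 * φ u 2)) * (-(2 * dmap φ u a 2)) := by
  have := hφ.diff 2
  rw [pd_exp (by fun_prop), pd_neg, pd_mul (by fun_prop) (by fun_prop), pd_const, dmap_pd]; ring

def pdv (a : Fin 2) (V : Pt 2 → Pt 3) (u : Pt 2) : Pt 3 := fun k => pd a (fun q => V q k) u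

lemma Sm.gam (hφ : Sm φ) (hX : Sm X) (hV : Sm V) : Sm (fun q => gam (φ q) (X q) (V q)) := by
  intro k
  have := hφ 2
  have := hX 0
  have := hX 1
  have := hX 2
  have := hV 0
  have := hV 1
  have := hV 2
  fin_cases k <;> simp [SolAux.gam] <;> fun_prop

lemma Sm.gip (hφ : Sm φ) (hX : Sm X) (hV : Sm V) :
    ContDiff ℝ (⊤ : ℕ∞) (fun q => gip solMet (φ q) (X q) (V q)) := by
  have := hφ 2
  have := hX 0
  have := hX 1
  have := hX 2
  have := hV 0
  have := hV 1
  have := hV 2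
  simp only [gip_sol]; fun_prop

lemma Sm.cov (hφ : Sm φ) (hV : Sm V) (a : Fin 2) : Sm (covAlong solMet φ V a) := by
  intro k
  simp only [covAlong_sol]
  exact (pd_contDiff (hV k) a).add (Sm.gam hφ (hφ.dmap a) hV k)

lemma pd_gam (hφ : Sm φ) (hX : Sm X) (hV : Sm V) (a : Fin 2) (u : Pt 2) (k : Fin 3) :
    pd a (fun q => gam (φ q) (X q) (V q) k) u =
      dgam (φ u) (dmap φ u a) (X u) (V u) k + gam (φ u) (pdv a X u) (V u) k
        + gam (φ u) (X u) (pdv a V u) k := by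
  have := hφ.diff 2
  have := hX.diff 0
  have := hX.diff 1
  have := hX.diff 2
  have := hV.diff 0
  have := hV.diff 1
  have := hV.diff 2
  fin_cases k
  · simp [SolAux.gam, dgam, pdv]
    rw [pd_add (by fun_prop) (by fun_prop), pd_mul (by fun_prop) (by fun_prop),
      pd_mul (by fun_prop) (by fun_prop)]; ring
  · simp [SolAux.gam, dgam, pdv]
    rw [pd_sub (by fun_prop) (by fun_prop), pd_neg, pd_mul (by fun_prop) (by fun_prop),
      pd_mul (by fun_prop) (by fun_prop)]; ring
  · simp [SolAux.gam, dgam, pdv]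
    rw [pd_add (by fun_prop) (by fun_prop), pd_neg, pd_mul (by fun_prop) (by fun_prop),
      pd_mul (by fun_prop) (by fun_prop), pd_mul (by fun_prop) (by fun_prop),
      pd_mul (by fun_prop) (by fun_prop), pdE hφ, pdF hφ]; ring

lemma gip_compat (hφ : Sm φ) (hV : Sm V) (hW : Sm W) (a : Fin 2) (u : Pt 2) :
    pd a (fun q => gip solMet (φ q) (V q) (W q)) u =
      gip solMet (φ u) (covAlong solMet φ V a u) (W u)
      + gip solMet (φ u) (V u) (covAlong solMet φ W a u) := by
  have := hφ.diff 2
  have := hW.diff 0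
  have := hW.diff 1
  have := hW.diff 2
  have := hV.diff 0
  have := hV.diff 1
  have := hV.diff 2
  simp only [gip_sol, covAlong_sol]
  rw [pd_add (by fun_prop) (by fun_prop), pd_add (by fun_prop) (by fun_prop),
    pd_mul (by fun_prop) (by fun_prop), pd_mul (by fun_prop) (by fun_prop),
    pd_mul (by fun_prop) (by fun_prop), pd_mul (by fun_prop) (by fun_prop),
    pd_mul (by fun_prop) (by fun_prop), pdE hφ, pdF hφ]
  have := EF (2 * φ u 2)
  simp [gam]
  grind

lemma torsion (hφ : Sm φ) (a b : Fin 2) (u : Pt 2) :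
    covAlong solMet φ (fun q => dmap φ q a) b u = covAlong solMet φ (fun q => dmap φ q b) a u := by
  ext k
  simp only [covAlong_sol, dmap_pd]
  rw [pd_comm (hφ k)]
  congr 1
  fin_cases k <;> simp [gam] <;> ring

lemma cov_smul {f : Pt 2 → ℝ} (hf : ContDiff ℝ (⊤ : ℕ∞) f) (hV : Sm V) (a : Fin 2) (u : Pt 2) :
    covAlong solMet φ (fun q => f q • V q) a u = pd a f u • V u + f u • covAlong solMet φ V a u := by
  ext k
  simp only [covAlong_sol, Pi.smul_apply, Pi.add_apply, smul_eq_mul]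
  rw [pd_mul (hf.differentiable (by simp)) (hV.diff k)]
  fin_cases k <;> simp [gam] <;> ring

lemma cov_add (hV : Sm V) (hW : Sm W) (a : Fin 2) (u : Pt 2) :
    covAlong solMet φ (fun q => V q + W q) a u =
      covAlong solMet φ V a u + covAlong solMet φ W a u := by
  ext k
  simp only [covAlong_sol, Pi.add_apply]
  rw [pd_add (hV.diff k) (hW.diff k)]
  fin_cases k <;> simp [gam] <;> ring

lemma ricci_id (hφ : Sm φ) (hV : Sm V) (a b : Fin 2) (u : Pt 2) :
    covAlong solMet φ (covAlong solMet φ V b) a u - covAlong solMet φ (covAlong solMet φ V a) b u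
      = curvPt solMet (φ u) (dmap φ u a) (dmap φ u b) (V u) := by
  have hc : ∀ c d, pdv c (fun q => dmap φ q d) u = pdv d (fun q => dmap φ q c) u := by
    intro c d; ext k; exact pd_comm (hφ k) _ _ _
  have key : ∀ c d k, covAlong solMet φ (covAlong solMet φ V d) c u k =
      pd c (pd d (fun q => V q k)) u + (dgam (φ u) (dmap φ u c) (dmap φ u d) (V u) k
        + gam (φ u) (pdv c (fun q => dmap φ q d) u) (V u) k
        + gam (φ u) (dmap φ u d) (pdv c V u) k)
      + gam (φ u) (dmap φ u c) (pdv d V u + gam (φ u) (dmap φ u d) (V u)) k := by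
    intro c d k
    rw [covAlong_sol]
    congr 1
    · simp only [covAlong_sol]
      rw [pd_add ((pd_contDiff (hV k) d).differentiable (by simp))
        ((Sm.gam hφ (hφ.dmap d) hV).diff k), pd_gam hφ (hφ.dmap d) hV]
    · congr 1; ext j; rw [covAlong_sol]; rfl
  ext k
  simp only [Pi.sub_apply, key, curvPt_sol]
  rw [pd_comm (hV k) b a, hc b a]
  fin_cases k <;> simp [gam, dgam] <;> ring

end along
section linalg
variable (p : Pt 3)

lemma gip_comm (v w : Pt 3) : gip solMet p v w = gip solMet p w v := by
  simp only [gip_sol]; ring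
lemma gip_add_left (v w z : Pt 3) :
    gip solMet p (v + w) z = gip solMet p v z + gip solMet p w z := by
  simp only [gip_sol, Pi.add_apply]; ring
lemma gip_sub_left (v w z : Pt 3) :
    gip solMet p (v - w) z = gip solMet p v z - gip solMet p w z := by
  simp only [gip_sol, Pi.sub_apply]; ring
lemma gip_smul_left (s : ℝ) (v z : Pt 3) :
    gip solMet p (s • v) z = s * gip solMet p v z := by
  simp only [gip_sol, Pi.smul_apply, smul_eq_mul]; ring
lemma gip_zero_left (z : Pt 3) : gip solMet p 0 z = 0 := by
  simp [gip_sol]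
lemma gip_self_zero {v : Pt 3} (h : gip solMet p v v = 0) : v = 0 := by
  rw [gip_sol] at h
  have h0 := Real.exp_pos (2 * p 2)
  have h1 := Real.exp_pos (-(2 * p 2))
  have a0 := mul_nonneg h0.le (mul_self_nonneg (v 0))
  have a1 := mul_nonneg h1.le (mul_self_nonneg (v 1))
  have a2 := mul_self_nonneg (v 2)
  have b0 : Real.exp (2 * p 2) * (v 0 * v 0) = 0 := by linarith
  have b1 : Real.exp (-(2 * p 2)) * (v 1 * v 1) = 0 := by linarith
  have b2 : v 2 * v 2 = 0 := by linarith
  simp at b0 b1 b2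
  ext k; fin_cases k <;> simpa

lemma nondeg {v : Fin 2 → Pt 3} (hv : LinearIndependent ℝ v) {ξ W : Pt 3}
    (h1 : gip solMet p ξ ξ = 1) (h2 : ∀ a, gip solMet p ξ (v a) = 0)
    (hW : ∀ a, gip solMet p W (v a) = 0) (hW2 : gip solMet p W ξ = 0) : W = 0 := by
  have hli : LinearIndependent ℝ ![v 0, v 1, ξ] := by
    rw [Fintype.linearIndependent_iff]
    intro c hc
    simp [Fin.sum_univ_three] at hc
    have e := congrArg (fun t => gip solMet p t ξ) hc
    simp only [gip_add_left, gip_smul_left, gip_zero_left, h1, gip_comm p (v _) ξ, h2] at e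
    have e2 : c 2 = 0 := by linarith
    rw [e2] at hc
    have := Fintype.linearIndependent_iff.1 hv ![c 0, c 1] (by simpa [Fin.sum_univ_two] using hc)
    have t0 := this 0
    have t1 := this 1
    intro i; fin_cases i <;> simp_all
  have hsp := hli.span_eq_top_of_card_eq_finrank (by simp)
  have hmem : W ∈ Submodule.span ℝ (Set.range ![v 0, v 1, ξ]) := by rw [hsp]; trivial
  have key : ∀ x ∈ Submodule.span ℝ (Set.range ![v 0, v 1, ξ]), gip solMet p x W = 0 := by
    intro x hx
    induction hx using Submodule.span_induction with
    | mem x h =>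
      obtain ⟨i, rfl⟩ := h
      rw [gip_comm]
      fin_cases i <;> simp [hW, hW2]
    | zero => exact gip_zero_left _ _
    | add x y _ _ hx hy => rw [gip_add_left, hx, hy, add_zero]
    | smul s x _ hx => rw [gip_smul_left, hx, mul_zero]
  exact gip_self_zero p (key W hmem)

lemma curv_smul (v w z : Pt 3) (s : ℝ) :
    curvPt solMet p v (s • w) z = s • curvPt solMet p v w z := by
  ext k
  simp only [Pi.smul_apply, smul_eq_mul, curvPt_sol]
  fin_cases k <;> simp [gam, dgam] <;> ring

lemma curv_pair (v w z t : Pt 3) :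
    gip solMet p (curvPt solMet p v w z) t = - gip solMet p (curvPt solMet p z t w) v := by
  have := EF (2 * p 2)
  simp only [gip_sol, curvPt_sol]
  simp [gam, dgam]
  grind

lemma curv_xi (v w ξ : Pt 3) :
    gip solMet p (curvPt solMet p v ξ w) ξ =
    -((v 0 * ξ 1 - v 1 * ξ 0) * (w 0 * ξ 1 - w 1 * ξ 0)
      - Real.exp (2 * p 2) * (v 0 * ξ 2 - v 2 * ξ 0) * (w 0 * ξ 2 - w 2 * ξ 0)
      - Real.exp (-(2 * p 2)) * (v 1 * ξ 2 - v 2 * ξ 1) * (w 1 * ξ 2 - w 2 * ξ 1)) := by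
  have := EF (2 * p 2)
  simp only [gip_sol, curvPt_sol]
  simp [gam, dgam]
  grind

end linalg

section main
variable {φ ξ : Pt 2 → Pt 3}

lemma fff_apply (u : Pt 2) (a b : Fin 2) :
    fff solMet φ u a b = gip solMet (φ u) (dmap φ u a) (dmap φ u b) := rfl

lemma fff_symm (u : Pt 2) (a b : Fin 2) : fff solMet φ u a b = fff solMet φ u b a := by
  rw [fff_apply, fff_apply, gip_comm]

lemma fff_diag_pos (hφ : IsImmersion φ) (u : Pt 2) (a : Fin 2) : fff solMet φ u a a ≠ 0 := by
  intro h
  exact (hφ.2 u).ne_zero a (gip_self_zero _ h)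

lemma fff_det (hφ : IsImmersion φ) (u : Pt 2) : IsUnit (fff solMet φ u).det := by
  rw [isUnit_iff_ne_zero, Matrix.det_fin_two]
  intro h
  have h10 := fff_symm (φ := φ) u 1 0
  have e : gip solMet (φ u)
      (fff solMet φ u 1 1 • dmap φ u 0 - fff solMet φ u 0 1 • dmap φ u 1)
      (fff solMet φ u 1 1 • dmap φ u 0 - fff solMet φ u 0 1 • dmap φ u 1) = 0 := by
    simp only [gip_sub_left, gip_smul_left]
    simp only [gip_comm _ _ (_ - _), gip_sub_left, gip_smul_left, ← fff_apply]
    rw [h10] at h ⊢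
    linear_combination (fff solMet φ u 1 1) * h
  have e2 := gip_self_zero _ e
  have := Fintype.linearIndependent_iff.1 (hφ.2 u) ![fff solMet φ u 1 1, - fff solMet φ u 0 1]
    (by simpa [Fin.sum_univ_two, sub_eq_add_neg] using e2) 0
  exact fff_diag_pos hφ u 1 this

lemma inv_mul_fff (hφ : IsImmersion φ) (u : Pt 2) (a b : Fin 2) :
    (fff solMet φ u)⁻¹ a 0 * fff solMet φ u 0 b + (fff solMet φ u)⁻¹ a 1 * fff solMet φ u 1 b
      = if a = b then 1 else 0 := by
  have := congrFun (congrFun (Matrix.nonsing_inv_mul _ (fff_det hφ u)) a) b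
  rwa [Matrix.mul_apply, Fin.sum_univ_two, Matrix.one_apply] at this

lemma inv_symm (u : Pt 2) : (fff solMet φ u)⁻¹ 1 0 = (fff solMet φ u)⁻¹ 0 1 := by
  have h : (fff solMet φ u).transpose = fff solMet φ u := by
    ext a b; exact fff_symm u b a
  have := Matrix.transpose_nonsing_inv (fff solMet φ u)
  rw [h] at this
  exact congrFun (congrFun this 0) 1

lemma chris_fff (hφ : IsImmersion φ) (u : Pt 2) (c a b : Fin 2) :
    christoffel (fff solMet φ) u c a b = ∑ l, (fff solMet φ u)⁻¹ c l *
      gip solMet (φ u) (covAlong solMet φ (fun q => dmap φ q b) a u) (dmap φ u l) := by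
  have hs : Sm φ := hφ.1
  have key : ∀ i j k : Fin 2, fderiv ℝ (fun q => fff solMet φ q j k) u (Pi.single i 1) =
      gip solMet (φ u) (covAlong solMet φ (fun q => dmap φ q j) i u) (dmap φ u k)
      + gip solMet (φ u) (dmap φ u j) (covAlong solMet φ (fun q => dmap φ q k) i u) :=
    fun i j k => gip_compat hs (hs.dmap j) (hs.dmap k) i u
  unfold christoffel
  rw [Finset.mul_sum]
  refine Finset.sum_congr rfl fun l _ => ?_
  rw [key, key, key, torsion hs a b, torsion hs l b, torsion hs l a,
    gip_comm _ (dmap φ u b), gip_comm _ (dmap φ u a)]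
  ring

lemma gauss (hφ : IsImmersion φ) (hξ : IsUnitNormal solMet φ ξ) (u : Pt 2) (a b : Fin 2) :
    covAlong solMet φ (fun q => dmap φ q b) a u
      - (christoffel (fff solMet φ) u 0 a b • dmap φ u 0
        + christoffel (fff solMet φ) u 1 a b • dmap φ u 1) = sff solMet φ ξ u a b • ξ u := by
  rw [← sub_eq_zero]
  have h1 := hξ.2.1 u
  have h2 := hξ.2.2 u
  have h3 : ∀ a, gip solMet (φ u) (dmap φ u a) (ξ u) = 0 := fun a => by rw [gip_comm, h2]
  refine nondeg (φ u) (hφ.2 u) h1 h2 ?_ ?_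
  · intro d
    simp only [gip_sub_left, gip_add_left, gip_smul_left, h2, ← fff_apply]
    rw [chris_fff hφ, chris_fff hφ]
    simp only [Fin.sum_univ_two]
    have i0 := inv_mul_fff hφ u 0 d
    have i1 := inv_mul_fff hφ u 1 d
    have s := inv_symm (φ := φ) u
    have t := fff_symm (φ := φ) u 1 0
    fin_cases d <;> simp at i0 i1 ⊢ <;> rw [s] at * <;> grind
  · simp only [gip_sub_left, gip_add_left, gip_smul_left, h1, h3]
    have : sff solMet φ ξ u a b =
      gip solMet (φ u) (covAlong solMet φ (fun q => dmap φ q b) a u) (ξ u) := rfl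
    rw [this]; ring

lemma tension_eq (hφ : IsImmersion φ) (hξ : IsUnitNormal solMet φ ξ) {lam : Pt 2 → ℝ}
    (hl : ∀ u a b, sff solMet φ ξ u a b = lam u * fff solMet φ u a b) (u : Pt 2) :
    tension solMet φ u = (2 * lam u) • ξ u := by
  have e : tension solMet φ u = ∑ a, ∑ b, (fff solMet φ u)⁻¹ a b •
      (covAlong solMet φ (fun q => dmap φ q b) a u
      - (christoffel (fff solMet φ) u 0 a b • dmap φ u 0
        + christoffel (fff solMet φ) u 1 a b • dmap φ u 1)) := by
    ext k
    simp only [Finset.sum_apply, Pi.smul_apply, smul_eq_mul, tension]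
    refine Finset.sum_congr rfl fun a _ => Finset.sum_congr rfl fun b _ => ?_
    simp only [Fin.sum_univ_two, Pi.sub_apply, Pi.add_apply, Pi.smul_apply, smul_eq_mul, covAlong]
    ring
  rw [e]
  simp only [gauss hφ hξ, hl, smul_smul, ← Finset.sum_smul]
  congr 1
  simp only [Fin.sum_univ_two]
  have i0 := inv_mul_fff hφ u 0 0
  have i1 := inv_mul_fff hφ u 1 1
  have t := fff_symm (φ := φ) u 1 0
  simp at i0 i1
  rw [t] at i0 ⊢
  linear_combination lam u * (i0 + i1)

lemma weingarten (hφ : IsImmersion φ) (hξ : IsUnitNormal solMet φ ξ) {lam : Pt 2 → ℝ}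
    (hl : ∀ u a b, sff solMet φ ξ u a b = lam u * fff solMet φ u a b) (a : Fin 2) (u : Pt 2) :
    covAlong solMet φ ξ a u = (-lam u) • dmap φ u a := by
  rw [← sub_eq_zero]
  have hs : Sm φ := hφ.1
  have hx : Sm ξ := hξ.1
  have h1 := hξ.2.1 u
  have h2 := hξ.2.2 u
  have h3 : ∀ a, gip solMet (φ u) (dmap φ u a) (ξ u) = 0 := fun a => by rw [gip_comm, h2]
  refine nondeg (φ u) (hφ.2 u) h1 h2 ?_ ?_
  · intro d
    have e := gip_compat hs hx (hs.dmap d) a u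
    simp only [hξ.2.2, pd_const] at e
    have e2 := hl u a d
    have : sff solMet φ ξ u a d =
      gip solMet (φ u) (covAlong solMet φ (fun q => dmap φ q d) a u) (ξ u) := rfl
    rw [this, gip_comm] at e2
    simp only [gip_sub_left, gip_smul_left, ← fff_apply]
    linarith
  · have e := gip_compat hs hx hx a u
    simp only [hξ.2.1, pd_const] at e
    rw [gip_comm _ (ξ u)] at e
    simp only [gip_sub_left, gip_smul_left, h3]
    linarith

lemma complete (hφ : IsImmersion φ) (hξ : IsUnitNormal solMet φ ξ) (u : Pt 2) (k l : Fin 3) :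
    ∑ a, ∑ b, (fff solMet φ u)⁻¹ a b * (dmap φ u a k * dmap φ u b l) =
      (solMet (φ u))⁻¹ k l - ξ u k * ξ u l := by
  have h1 := hξ.2.1 u
  have h2 := hξ.2.2 u
  have h3 : ∀ a, gip solMet (φ u) (dmap φ u a) (ξ u) = 0 := fun a => by rw [gip_comm, h2]
  have hk : ∀ w, gip solMet (φ u) (fun l => (solMet (φ u))⁻¹ k l) w = w k := by
    intro w
    have := EF (2 * φ u 2)
    rw [gip_sol, sol_inv]
    fin_cases k <;> simp [Matrix.diagonal_apply] <;> grind
  have hz : (fun l => (solMet (φ u))⁻¹ k l) - (ξ u k) • ξ u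
      - ∑ a, ∑ b, ((fff solMet φ u)⁻¹ a b * dmap φ u a k) • dmap φ u b = 0 := by
    refine nondeg (φ u) (hφ.2 u) h1 h2 ?_ ?_
    · intro d
      simp only [Fin.sum_univ_two, gip_sub_left, gip_add_left, gip_smul_left, h2, hk, ← fff_apply]
      have i0 := inv_mul_fff hφ u 0 d
      have i1 := inv_mul_fff hφ u 1 d
      fin_cases d <;> simp at i0 i1 ⊢
      · linear_combination -dmap φ u 0 k * i0 - dmap φ u 1 k * i1
      · linear_combination -dmap φ u 0 k * i0 - dmap φ u 1 k * i1
    · simp only [Fin.sum_univ_two, gip_sub_left, gip_add_left, gip_smul_left, h1, h3, hk]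
      ring
  have := congrFun hz l
  simp [Fin.sum_univ_two] at this
  simp only [Fin.sum_univ_two]
  linarith

lemma trace_curv (hφ : IsImmersion φ) (hξ : IsUnitNormal solMet φ ξ) (u : Pt 2) :
    ∑ a, ∑ b, (fff solMet φ u)⁻¹ a b *
      gip solMet (φ u) (curvPt solMet (φ u) (dmap φ u a) (ξ u) (dmap φ u b)) (ξ u) =
      2 * ξ u 2 ^ 2 := by
  have c := complete hφ hξ u
  have c00 := c 0 0
  have c01 := c 0 1
  have c02 := c 0 2
  have c10 := c 1 0
  have c11 := c 1 1
  have c12 := c 1 2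
  have c20 := c 2 0
  have c21 := c 2 1
  have c22 := c 2 2
  have h := EF (2 * φ u 2)
  simp only [curv_xi]
  simp [sol_inv, Fin.sum_univ_two] at c00 c01 c02 c10 c11 c12 c20 c21 c22 ⊢
  set E := Real.exp (2 * φ u 2)
  set F := Real.exp (-(2 * φ u 2))
  set x := ξ u 0
  set y := ξ u 1
  set z := ξ u 2
  linear_combination (E * z ^ 2 - y ^ 2) * c00 + x * y * (c01 + c10) - E * x * z * (c02 + c20)
    + (F * z ^ 2 - x ^ 2) * c11 - F * y * z * (c12 + c21) + (E * x ^ 2 + F * y ^ 2) * c22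
    + 2 * z ^ 2 * h

lemma lam_smooth (hφ : IsImmersion φ) (hξ : IsUnitNormal solMet φ ξ) {lam : Pt 2 → ℝ}
    (hl : ∀ u a b, sff solMet φ ξ u a b = lam u * fff solMet φ u a b) :
    ContDiff ℝ (⊤ : ℕ∞) lam := by
  have hs : Sm φ := hφ.1
  have e : lam = fun u =>
      gip solMet (φ u) (covAlong solMet φ (fun q => dmap φ q 0) 0 u) (ξ u) /
      gip solMet (φ u) (dmap φ u 0) (dmap φ u 0) := by
    ext u
    have hne : gip solMet (φ u) (dmap φ u 0) (dmap φ u 0) ≠ 0 := fff_diag_pos hφ u 0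
    rw [eq_div_iff hne]
    exact (hl u 0 0).symm
  rw [e]
  exact (Sm.gip hs (Sm.cov hs (hs.dmap 0) 0) hξ.1).div (Sm.gip hs (hs.dmap 0) (hs.dmap 0))
    (fun u => fff_diag_pos hφ u 0)

lemma codazzi (hφ : IsImmersion φ) (hξ : IsUnitNormal solMet φ ξ) {lam : Pt 2 → ℝ}
    (hl : ∀ u a b, sff solMet φ ξ u a b = lam u * fff solMet φ u a b) (a b : Fin 2) (u : Pt 2) :
    curvPt solMet (φ u) (dmap φ u a) (dmap φ u b) (ξ u) =
      pd b lam u • dmap φ u a - pd a lam u • dmap φ u b := by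
  have hs : Sm φ := hφ.1
  have hL := lam_smooth hφ hξ hl
  rw [← ricci_id hs hξ.1]
  have e : ∀ c, covAlong solMet φ ξ c = fun q => (fun q => -lam q) q • dmap φ q c := by
    intro c; funext q; exact weingarten hφ hξ hl c q
  rw [e, e, cov_smul hL.neg (hs.dmap b), cov_smul hL.neg (hs.dmap a), pd_neg, pd_neg,
    torsion hs a b]
  module

lemma bitension_eq (hφ : IsImmersion φ) (hξ : IsUnitNormal solMet φ ξ) {lam : Pt 2 → ℝ}
    (hl : ∀ u a b, sff solMet φ ξ u a b = lam u * fff solMet φ u a b) (u : Pt 2) :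
    bitension solMet φ u = ∑ a, ∑ b, (fff solMet φ u)⁻¹ a b •
      ((2 * (pd a (pd b lam) u - christoffel (fff solMet φ) u 0 a b * pd 0 lam u
        - christoffel (fff solMet φ) u 1 a b * pd 1 lam u)
        - 2 * lam u ^ 3 * fff solMet φ u a b) • ξ u
      - (2 * lam u * pd b lam u) • dmap φ u a - (4 * lam u * pd a lam u) • dmap φ u b
      - (2 * lam u) • curvPt solMet (φ u) (dmap φ u a) (ξ u) (dmap φ u b)) := by
  have hs : Sm φ := hφ.1
  have hx : Sm ξ := hξ.1
  have hL := lam_smooth hφ hξ hl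
  have hT : tension solMet φ = fun q => (fun q => 2 * lam q) q • ξ q := by
    funext q; exact tension_eq hφ hξ hl q
  have h2L : ContDiff ℝ (⊤ : ℕ∞) (fun q => 2 * lam q) := contDiff_const.mul hL
  have hLL : ContDiff ℝ (⊤ : ℕ∞) (fun q => -2 * lam q * lam q) := (contDiff_const.mul hL).mul hL
  have hd := hL.differentiable (by simp)
  have p2 : ∀ c q, pd c (fun q => 2 * lam q) q = 2 * pd c lam q := by
    intro c q
    rw [pd_mul (by fun_prop) hd, pd_const]; ring
  have pLL : ∀ c q, pd c (fun q => -2 * lam q * lam q) q = -4 * lam q * pd c lam q := by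
    intro c q
    rw [pd_mul (by fun_prop) hd, pd_mul (by fun_prop) hd, pd_const]; ring
  have hDT : ∀ c, covAlong solMet φ (tension solMet φ) c = fun q =>
      (fun q => (fun q => 2 * pd c lam q) q • ξ q) q
      + (fun q => (fun q => -2 * lam q * lam q) q • dmap φ q c) q := by
    intro c; funext q
    rw [hT, cov_smul h2L hx, weingarten hφ hξ hl, p2]
    module
  have hpd : ∀ c, ContDiff ℝ (⊤ : ℕ∞) (fun q => 2 * pd c lam q) :=
    fun c => contDiff_const.mul (pd_contDiff hL c)
  have ppd : ∀ a c q, pd a (fun q => 2 * pd c lam q) q = 2 * pd a (pd c lam) q := by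
    intro a c q
    rw [pd_mul (by fun_prop) ((pd_contDiff hL c).differentiable (by simp)), pd_const]; ring
  have hDDT : ∀ a c, covAlong solMet φ (covAlong solMet φ (tension solMet φ) c) a u =
      (2 * pd a (pd c lam) u) • ξ u - (2 * lam u * pd c lam u) • dmap φ u a
      - (4 * lam u * pd a lam u) • dmap φ u c
      - (2 * lam u ^ 2) • covAlong solMet φ (fun q => dmap φ q c) a u := by
    intro a c
    have s1 : Sm (fun q => (fun q => 2 * pd c lam q) q • ξ q) := fun k => (hpd c).mul (hx k)
    have s2 : Sm (fun q => (fun q => -2 * lam q * lam q) q • dmap φ q c) :=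
      fun k => hLL.mul (hs.dmap c k)
    rw [hDT, cov_add s1 s2, cov_smul (hpd c) hx, cov_smul hLL (hs.dmap c), ppd, pLL,
      weingarten hφ hξ hl]
    module
  have e : bitension solMet φ u = ∑ a, ∑ b, (fff solMet φ u)⁻¹ a b •
      ((covAlong solMet φ (covAlong solMet φ (tension solMet φ) b) a u
        - (christoffel (fff solMet φ) u 0 a b • covAlong solMet φ (tension solMet φ) 0 u
          + christoffel (fff solMet φ) u 1 a b • covAlong solMet φ (tension solMet φ) 1 u))
        - curvPt solMet (φ u) (dmap φ u a) (tension solMet φ u) (dmap φ u b)) := by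
    ext k
    simp only [bitension, Fin.sum_univ_two, Pi.sub_apply, Pi.add_apply, Pi.smul_apply, smul_eq_mul]
    ring
  rw [e]
  refine Finset.sum_congr rfl fun a _ => Finset.sum_congr rfl fun b _ => ?_
  congr 1
  rw [hDDT, hDT, hDT, tension_eq hφ hξ hl, curv_smul]
  have g := gauss hφ hξ u a b
  rw [sub_eq_iff_eq_add, hl] at g
  rw [g]
  module

lemma tangent_part (hφ : IsImmersion φ) (hξ : IsUnitNormal solMet φ ξ) {lam : Pt 2 → ℝ}
    (hl : ∀ u a b, sff solMet φ ξ u a b = lam u * fff solMet φ u a b)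
    (hb : IsBiharmonic solMet φ) (u : Pt 2) (c : Fin 2) : lam u * pd c lam u = 0 := by
  have h := congrArg (fun t => gip solMet (φ u) t (dmap φ u c)) (hb u)
  rw [bitension_eq hφ hξ hl] at h
  have h2 := hξ.2.2 u
  simp only [Fin.sum_univ_two, gip_add_left, gip_sub_left, gip_smul_left, h2, gip_zero_left,
    curv_pair _ _ (ξ u), codazzi hφ hξ hl, ← fff_apply] at h
  have s := inv_symm (φ := φ) u
  have t := fff_symm (φ := φ) u 1 0
  have i00 := inv_mul_fff hφ u 0 0
  have i01 := inv_mul_fff hφ u 0 1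
  have i10 := inv_mul_fff hφ u 1 0
  have i11 := inv_mul_fff hφ u 1 1
  simp at i00 i01 i10 i11
  simp only [s, t] at h i00 i01 i10 i11
  fin_cases c <;> simp at h ⊢
  all_goals rw [← mul_eq_zero]
  all_goals simp only [s, t] at h
  · linear_combination (-1/4) * h - lam u * pd 0 lam u * (3 / 2 * i00 - 1 / 2 * i11) - 2 * lam u * pd 1 lam u * i10
  · linear_combination (-1/4) * h - lam u * pd 1 lam u * (3 / 2 * i11 - 1 / 2 * i00) - 2 * lam u * pd 0 lam u * i01

theorem forward (hφ : IsImmersion φ) (hξ : IsUnitNormal solMet φ ξ) {lam : Pt 2 → ℝ}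
    (hl : ∀ u a b, sff solMet φ ξ u a b = lam u * fff solMet φ u a b)
    (hb : IsBiharmonic solMet φ) (u : Pt 2) : lam u = 0 := by
  have hL := lam_smooth hφ hξ hl
  have hd := hL.differentiable (by simp)
  have ht := tangent_part hφ hξ hl hb
  by_contra hne
  have hsq : ∀ q, lam q * lam q = lam u * lam u := by
    intro q
    refine is_const_of_fderiv_eq_zero (𝕜 := ℝ) (f := fun q => lam q * lam q) (by fun_prop) ?_ q u
    intro q
    ext v
    have hv : v = v 0 • Pi.single 0 1 + v 1 • Pi.single 1 1 := by
      ext i; fin_cases i <;> simp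
    have key : ∀ c : Fin 2, fderiv ℝ (fun q => lam q * lam q) q (Pi.single c 1) = 0 := by
      intro c
      have := pd_mul hd hd c q
      unfold pd at this
      rw [this]
      have := ht q c
      unfold pd at this
      linarith
    rw [hv, map_add, map_smul, map_smul, key, key]; simp
  have hnz : ∀ q, lam q ≠ 0 := by
    intro q h0
    have := hsq q
    rw [h0] at this
    simp at this; exact hne this
  have hp : ∀ c, pd c lam = fun _ => 0 := by
    intro c; funext q
    exact (mul_eq_zero.1 (ht q c)).resolve_left (hnz q)
  have h := congrArg (fun t => gip solMet (φ u) t (ξ u)) (hb u)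
  rw [bitension_eq hφ hξ hl] at h
  have h1 := hξ.2.1 u
  have h3 : ∀ a, gip solMet (φ u) (dmap φ u a) (ξ u) = 0 := fun a => by rw [gip_comm, hξ.2.2 u]
  have hc := trace_curv hφ hξ u
  simp only [Fin.sum_univ_two] at hc
  simp only [Fin.sum_univ_two, gip_add_left, gip_sub_left, gip_smul_left, h1, h3, gip_zero_left,
    hp, pd_const] at h
  have t := fff_symm (φ := φ) u 1 0
  have i00 := inv_mul_fff hφ u 0 0
  have i11 := inv_mul_fff hφ u 1 1
  simp at i00 i11
  rw [t] at h i00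
  have fin : lam u * (lam u ^ 2 + ξ u 2 ^ 2) = 0 := by
    linear_combination (-1/4) * h - (1/2) * lam u ^ 3 * (i00 + i11) - (1/2) * lam u * hc
  have : 0 < lam u ^ 2 + ξ u 2 ^ 2 := by positivity
  rcases mul_eq_zero.1 fin with h | h
  · exact hne h
  · linarith

lemma backward (h : IsMinimal solMet φ) : IsBiharmonic solMet φ := by
  intro u
  have hT : tension solMet φ = fun _ => 0 := funext h
  have hD : ∀ c, covAlong solMet φ (fun _ => 0) c = fun _ => 0 := by
    intro c; funext q; ext k; simp [covAlong]
  have hc : ∀ v z, curvPt solMet (φ u) v 0 z = 0 := by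
    intro v z
    have := curv_smul (φ u) v 0 z 0
    simpa using this
  ext k
  simp [bitension, hT, hD, hc]

end main
end SolAux

/-- Corollary 3.2. A totally umbilical surface in Sol space
`(ℝ³, g_{Sol} = e^{2z}dx² + e^{−2z}dy² + dz²)` is biharmonic if and only if it is minimal. -/
theorem totally_umbilical_biharmonic_surface_in_Sol_is_minimal
    (φ ξ : Pt 2 → Pt 3) (hφ : IsImmersion φ) (hξ : IsUnitNormal solMet φ ξ)
    (humb : IsTotallyUmbilical solMet φ ξ) :
    IsBiharmonic solMet φ ↔ IsMinimal solMet φ := by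
  obtain ⟨lam, hl⟩ := humb
  refine ⟨fun hb u => ?_, SolAux.backward⟩
  rw [SolAux.tension_eq hφ hξ hl, SolAux.forward hφ hξ hl hb u]
  simp
end
end

section
/- A totally umbilical surface in a 3-dimensional Bianchi–Cartan–Vranceanu space M³_{m,l} is proper biharmonic if and only if it is a part of S²(1/√(2m)) in S³(1/√m). -/
/-!
Coordinate-based Riemannian geometry on charts `ℝⁿ`, enough to express mean
curvature, second fundamental forms, curvature tensors and the (bi)tension
fields of isometric immersions, as used in
"Constant mean curvature and totally umbilical biharmonic surfaces in
3-dimensional geometries".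
-/

noncomputable section

open scoped BigOperators

/-- directional derivative predicate -/
def DD {n : ℕ} (f : Pt n → ℝ) (p v : Pt n) (d : ℝ) : Prop :=
  DifferentiableAt ℝ f p ∧ fderiv ℝ f p v = d

namespace DD
variable {n : ℕ} {f g : Pt n → ℝ} {p v : Pt n} {c d : ℝ}

theorem congr (h : DD f p v c) (e : c = d) : DD f p v d := e ▸ h

theorem const (a : ℝ) : DD (fun _ => a) p v 0 := ⟨by fun_prop, by simp⟩

theorem coord (k : Fin n) : DD (fun q => q k) p v (v k) :=
  ⟨by fun_prop, by
    rw [(hasFDerivAt_apply (𝕜 := ℝ) k p).fderiv]; rfl⟩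

theorem add (hf : DD f p v c) (hg : DD g p v d) : DD (fun q => f q + g q) p v (c + d) :=
  ⟨hf.1.add hg.1, by
    rw [(hf.1.hasFDerivAt.fun_add hg.1.hasFDerivAt).fderiv]; simp [hf.2, hg.2]⟩

theorem sub (hf : DD f p v c) (hg : DD g p v d) : DD (fun q => f q - g q) p v (c - d) :=
  ⟨hf.1.sub hg.1, by
    rw [(hf.1.hasFDerivAt.fun_sub hg.1.hasFDerivAt).fderiv]; simp [hf.2, hg.2]⟩

theorem neg (hf : DD f p v c) : DD (fun q => - f q) p v (-c) :=
  ⟨hf.1.neg, by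
    rw [(hf.1.hasFDerivAt.fun_neg).fderiv]; simp [hf.2]⟩

theorem mul (hf : DD f p v c) (hg : DD g p v d) :
    DD (fun q => f q * g q) p v (c * g p + f p * d) :=
  ⟨hf.1.mul hg.1, by
    rw [(hf.1.hasFDerivAt.fun_mul hg.1.hasFDerivAt).fderiv]; simp [hf.2, hg.2]; ring⟩

theorem inv (hf : DD f p v c) (h0 : f p ≠ 0) :
    DD (fun q => (f q)⁻¹) p v (-(c * (f p)⁻¹ * (f p)⁻¹)) :=
  ⟨hf.1.inv h0, by
    have := (hasDerivAt_inv h0).comp_hasFDerivAt p hf.1.hasFDerivAt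
    have h2 : fderiv ℝ (fun q => (f q)⁻¹) p = _ := this.fderiv
    rw [h2]; simp [hf.2]; field_simp⟩
end DD

/-- `1/F` -/
def bW (m : ℝ) (p : Pt 3) : ℝ := (bcvF m p)⁻¹
/-- the contact form -/
def bom (m l : ℝ) (p v : Pt 3) : ℝ := v 2 + l / 2 * (bW m p * (p 1 * v 0 - p 0 * v 1))
/-- derivative of `bW` -/
def dW (m : ℝ) (p v : Pt 3) : ℝ := -(2 * m * (p 0 * v 0 + p 1 * v 1) * bW m p * bW m p)
/-- derivative of `bom` -/
def dom (m l : ℝ) (p v x : Pt 3) : ℝ :=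
  l / 2 * (dW m p v * (p 1 * x 0 - p 0 * x 1) + bW m p * (v 1 * x 0 - v 0 * x 1))
/-- derivative of the metric -/
def dgip (m l : ℝ) (p v x y : Pt 3) : ℝ :=
  2 * bW m p * dW m p v * (x 0 * y 0 + x 1 * y 1)
    + dom m l p v x * bom m l p y + bom m l p x * dom m l p v y

theorem gip_eq (m l : ℝ) (p v w : Pt 3) :
    gip (bcvMet m l) p v w = bW m p * bW m p * (v 0 * w 0 + v 1 * w 1)
      + bom m l p v * bom m l p w := by
  simp [gip, bcvMet, bcvω, bom, bW, Fin.sum_univ_three, Matrix.of_apply]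
  ring

/-- Christoffel bilinear map, x-part -/
def G0 (m l : ℝ) (p u v : Pt 3) : ℝ :=
  -(2 * m * (bW m p * p 0)) * (u 0 * v 0 - u 1 * v 1)
    - 2 * m * (bW m p * p 1) * (u 0 * v 1 + u 1 * v 0)
    + l / 2 * (bom m l p u * v 1 + bom m l p v * u 1)
/-- y-part -/
def G1 (m l : ℝ) (p u v : Pt 3) : ℝ :=
  2 * m * (bW m p * p 1) * (u 0 * v 0 - u 1 * v 1)
    - 2 * m * (bW m p * p 0) * (u 0 * v 1 + u 1 * v 0)
    - l / 2 * (bom m l p u * v 0 + bom m l p v * u 0)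
/-- z-part -/
def G2 (m l : ℝ) (p u v : Pt 3) : ℝ :=
  -(l / 2 * (bW m p * (p 1 * G0 m l p u v - p 0 * G1 m l p u v)))
    - l * m * (bW m p * bW m p * (p 0 * p 1)) * (u 0 * v 0 - u 1 * v 1)
    + l * m / 2 * (bW m p * bW m p * (p 0 * p 0 - p 1 * p 1)) * (u 0 * v 1 + u 1 * v 0)
/-- Christoffel bilinear map -/
def Gam (m l : ℝ) (p u v : Pt 3) : Pt 3 := ![G0 m l p u v, G1 m l p u v, G2 m l p u v]

theorem bW_mul {m : ℝ} {p : Pt 3} (h : bcvF m p ≠ 0) :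
    bW m p * (1 + m * (p 0 * p 0 + p 1 * p 1)) = 1 := by
  have : bcvF m p = 1 + m * (p 0 * p 0 + p 1 * p 1) := by unfold bcvF; ring
  rw [← this]; exact inv_mul_cancel₀ h

theorem om_Gam (m l : ℝ) (p u v : Pt 3) : bom m l p (Gam m l p u v) =
    - l * m * (bW m p * bW m p * (p 0 * p 1)) * (u 0 * v 0 - u 1 * v 1)
    + l * m / 2 * (bW m p * bW m p * (p 0 * p 0 - p 1 * p 1)) * (u 0 * v 1 + u 1 * v 0) := by
  simp only [bom, Gam, G2, Matrix.cons_val_zero, Matrix.cons_val_one, Matrix.cons_val]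
  ring

theorem koszul {m : ℝ} (l : ℝ) {p : Pt 3} (h : bcvF m p ≠ 0) (u v z : Pt 3) :
    (dgip m l p u v z + dgip m l p v u z - dgip m l p z u v) / 2
      = gip (bcvMet m l) p (Gam m l p u v) z := by
  have hW := bW_mul h
  rw [gip_eq, om_Gam]
  have e0 : Gam m l p u v 0 = G0 m l p u v := rfl
  have e1 : Gam m l p u v 1 = G1 m l p u v := rfl
  rw [e0, e1]
  simp only [dgip, dom, dW, G0, G1]
  generalize h1 : bom m l p u = a
  generalize h2 : bom m l p v = b
  generalize h3 : bom m l p z = c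
  generalize bW m p = W at *
  generalize p 0 = x at *
  generalize p 1 = y at *
  linear_combination (-(l/2*W*(a * (v 1 * z 0 - v 0 * z 1) + b * (u 1 * z 0 - u 0 * z 1))))*hW

theorem DD_F (m : ℝ) (p v : Pt 3) :
    DD (fun q => bcvF m q) p v (2 * m * (p 0 * v 0 + p 1 * v 1)) := by
  have : (fun q : Pt 3 => bcvF m q) = fun q => 1 + m * (q 0 * q 0 + q 1 * q 1) := by
    funext q; unfold bcvF; ring
  rw [this]
  refine DD.congr (DD.add (DD.const _) (DD.mul (DD.const _) (DD.add (DD.mul (DD.coord _) (DD.coord _))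
    (DD.mul (DD.coord _) (DD.coord _))))) ?_
  ring

theorem DD_W {m : ℝ} {p : Pt 3} (h : bcvF m p ≠ 0) (v : Pt 3) :
    DD (fun q => bW m q) p v (dW m p v) :=
  DD.congr (DD.inv (DD_F m p v) h) (by unfold dW bW; ring)

theorem DD_gip {m : ℝ} (l : ℝ) {p : Pt 3} (h : bcvF m p ≠ 0) (v x y : Pt 3) :
    DD (fun q => gip (bcvMet m l) q x y) p v (dgip m l p v x y) := by
  simp only [gip_eq, bom]
  have hW := DD_W h v
  refine DD.congr (DD.add (DD.mul (hW.mul hW) (DD.const _)) (DD.mul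
    (DD.add (DD.const _) (DD.mul (DD.const _) (hW.mul (DD.sub ((DD.coord _).mul (DD.const _)) ((DD.coord _).mul (DD.const _))))))
    (DD.add (DD.const _) (DD.mul (DD.const _) (hW.mul (DD.sub ((DD.coord _).mul (DD.const _)) ((DD.coord _).mul (DD.const _)))))))) ?_
  simp only [dgip, dom, bom]; ring

theorem gip_single (g : Met 3) (p : Pt 3) (i j : Fin 3) :
    gip g p (Pi.single i 1) (Pi.single j 1) = g p i j := by
  simp [gip, Pi.single_apply]

theorem gip_single_right (g : Met 3) (p x : Pt 3) (j : Fin 3) :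
    gip g p x (Pi.single j 1) = ∑ i, g p i j * x i := by
  simp [gip, Pi.single_apply]

theorem bcv_symm (m l : ℝ) (p : Pt 3) (i j : Fin 3) : bcvMet m l p i j = bcvMet m l p j i := by
  rw [← gip_single (bcvMet m l), ← gip_single (bcvMet m l), gip_eq, gip_eq]; ring

theorem bcv_det {m : ℝ} (l : ℝ) {p : Pt 3} (h : bcvF m p ≠ 0) : IsUnit (bcvMet m l p).det := by
  have : (bcvMet m l p).det = (bW m p)^4 := by
    rw [Matrix.det_fin_three]
    simp only [← gip_single (bcvMet m l), gip_eq, bom]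
    simp [Pi.single_apply]
    ring
  rw [this, isUnit_iff_ne_zero]
  exact pow_ne_zero _ (inv_ne_zero h)

theorem christ_eq {m : ℝ} (l : ℝ) {p : Pt 3} (h : bcvF m p ≠ 0) (k i j : Fin 3) :
    christoffel (bcvMet m l) p k i j = Gam m l p (Pi.single i 1) (Pi.single j 1) k := by
  have hd : ∀ i j : Fin 3, ∀ v, fderiv ℝ (fun q => bcvMet m l q i j) p v
      = dgip m l p v (Pi.single i 1) (Pi.single j 1) := by
    intro i j v
    have := (DD_gip l h v (Pi.single i 1) (Pi.single j 1)).2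
    simpa only [gip_single] using this
  unfold christoffel
  simp only [hd]
  have key : ∀ r : Fin 3, (dgip m l p (Pi.single i 1) (Pi.single j 1) (Pi.single r 1)
      + dgip m l p (Pi.single j 1) (Pi.single i 1) (Pi.single r 1)
      - dgip m l p (Pi.single r 1) (Pi.single i 1) (Pi.single j 1))
      = 2 * (bcvMet m l p).mulVec (Gam m l p (Pi.single i 1) (Pi.single j 1)) r := by
    intro r
    have := koszul l h (Pi.single i 1) (Pi.single j 1) (Pi.single r 1)
    rw [gip_single_right] at this
    simp only [Matrix.mulVec, dotProduct]
    rw [div_eq_iff two_ne_zero] at this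
    rw [this, mul_comm]
    congr 1
    exact Finset.sum_congr rfl fun s _ => by rw [bcv_symm]
  simp only [key]
  have h3 : (bcvMet m l p)⁻¹.mulVec ((bcvMet m l p).mulVec (Gam m l p (Pi.single i 1) (Pi.single j 1))) k
     = Gam m l p (Pi.single i 1) (Pi.single j 1) k := by
    rw [Matrix.mulVec_mulVec, Matrix.nonsing_inv_mul _ (bcv_det l h), Matrix.one_mulVec]
  rw [← h3]
  conv_rhs => rw [Matrix.mulVec, dotProduct]
  rw [Finset.mul_sum]
  exact Finset.sum_congr rfl fun s _ => by ring

theorem christ_sum {m : ℝ} (l : ℝ) {p : Pt 3} (h : bcvF m p ≠ 0) (k : Fin 3) (u v : Pt 3) :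
    ∑ i, ∑ j, christoffel (bcvMet m l) p k i j * u i * v j = Gam m l p u v k := by
  simp only [christ_eq l h]
  fin_cases k <;>
  simp [Gam, G0, G1, G2, bom, Fin.sum_univ_three, Pi.single_apply] <;> ring

def dG0 (m l : ℝ) (p d u v : Pt 3) : ℝ :=
  -(2 * m * (dW m p d * p 0 + bW m p * d 0)) * (u 0 * v 0 - u 1 * v 1)
    - 2 * m * (dW m p d * p 1 + bW m p * d 1) * (u 0 * v 1 + u 1 * v 0)
    + l / 2 * (dom m l p d u * v 1 + dom m l p d v * u 1)
def dG1 (m l : ℝ) (p d u v : Pt 3) : ℝ :=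
  2 * m * (dW m p d * p 1 + bW m p * d 1) * (u 0 * v 0 - u 1 * v 1)
    - 2 * m * (dW m p d * p 0 + bW m p * d 0) * (u 0 * v 1 + u 1 * v 0)
    - l / 2 * (dom m l p d u * v 0 + dom m l p d v * u 0)
def dG2 (m l : ℝ) (p d u v : Pt 3) : ℝ :=
  -(l / 2 * (dW m p d * (p 1 * G0 m l p u v - p 0 * G1 m l p u v)
      + bW m p * (d 1 * G0 m l p u v + p 1 * dG0 m l p d u v
        - d 0 * G1 m l p u v - p 0 * dG1 m l p d u v)))
    - l * m * (2 * bW m p * dW m p d * (p 0 * p 1)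
        + bW m p * bW m p * (d 0 * p 1 + p 0 * d 1)) * (u 0 * v 0 - u 1 * v 1)
    + l * m / 2 * (2 * bW m p * dW m p d * (p 0 * p 0 - p 1 * p 1)
        + bW m p * bW m p * (2 * p 0 * d 0 - 2 * p 1 * d 1)) * (u 0 * v 1 + u 1 * v 0)
def dGam (m l : ℝ) (p d u v : Pt 3) : Pt 3 :=
  ![dG0 m l p d u v, dG1 m l p d u v, dG2 m l p d u v]

/-- componentwise directional derivative -/
def DV {n : ℕ} (X : Pt n → Pt 3) (u a : Pt n) (d : Pt 3) : Prop :=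
  ∀ k, DD (fun q => X q k) u a (d k)

section chain
variable {n : ℕ} {m l : ℝ} {ψ X Y : Pt n → Pt 3} {u a : Pt n} {ψ' X' Y' : Pt 3}

theorem DD_Wc (hF : bcvF m (ψ u) ≠ 0) (hψ : DV ψ u a ψ') :
    DD (fun q => bW m (ψ q)) u a (dW m (ψ u) ψ') := by
  have : (fun q => bW m (ψ q)) = fun q => (1 + m * (ψ q 0 * ψ q 0 + ψ q 1 * ψ q 1))⁻¹ := by
    funext q; unfold bW bcvF; ring_nf
  rw [this]
  have e : 1 + m * (ψ u 0 * ψ u 0 + ψ u 1 * ψ u 1) = bcvF m (ψ u) := by unfold bcvF; ring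
  refine DD.congr (DD.inv (DD.add (DD.const _) (DD.mul (DD.const _)
    (DD.add (DD.mul (hψ 0) (hψ 0)) (DD.mul (hψ 1) (hψ 1))))) (by rw [e]; exact hF)) ?_
  rw [e, dW, bW]; ring

theorem DD_omc (hF : bcvF m (ψ u) ≠ 0) (hψ : DV ψ u a ψ') (hX : DV X u a X') :
    DD (fun q => bom m l (ψ q) (X q)) u a (dom m l (ψ u) ψ' (X u) + bom m l (ψ u) X') := by
  unfold bom
  have hW := DD_Wc hF hψ
  refine DD.congr (DD.add (hX 2) (DD.mul (DD.const _) (hW.mul (DD.sub ((hψ 1).mul (hX 0)) ((hψ 0).mul (hX 1)))))) ?_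
  simp only [dom]; ring

theorem DD_gipc (hF : bcvF m (ψ u) ≠ 0) (hψ : DV ψ u a ψ') (hX : DV X u a X') (hY : DV Y u a Y') :
    DD (fun q => gip (bcvMet m l) (ψ q) (X q) (Y q)) u a
      (dgip m l (ψ u) ψ' (X u) (Y u) + gip (bcvMet m l) (ψ u) X' (Y u)
        + gip (bcvMet m l) (ψ u) (X u) Y') := by
  simp only [gip_eq]
  have hW := DD_Wc hF hψ
  refine DD.congr (DD.add (DD.mul (hW.mul hW) (DD.add ((hX 0).mul (hY 0)) ((hX 1).mul (hY 1))))
    (DD.mul (DD_omc hF hψ hX) (DD_omc hF hψ hY))) ?_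
  simp only [dgip]; ring

theorem DD_G0c (hF : bcvF m (ψ u) ≠ 0) (hψ : DV ψ u a ψ') (hX : DV X u a X') (hY : DV Y u a Y') :
    DD (fun q => G0 m l (ψ q) (X q) (Y q)) u a
      (dG0 m l (ψ u) ψ' (X u) (Y u) + G0 m l (ψ u) X' (Y u) + G0 m l (ψ u) (X u) Y') := by
  unfold G0
  have hW := DD_Wc hF hψ
  have hx := DD_omc (l := l) hF hψ hX
  have hy := DD_omc (l := l) hF hψ hY
  refine DD.congr (((((DD.const _).mul (hW.mul (hψ 0))).neg.mul (((hX 0).mul (hY 0)).sub ((hX 1).mul (hY 1)))).sub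
    (((DD.const _).mul (hW.mul (hψ 1))).mul (((hX 0).mul (hY 1)).add ((hX 1).mul (hY 0))))).add
    ((DD.const _).mul ((hx.mul (hY 1)).add (hy.mul (hX 1))))) ?_
  simp only [dG0]; ring

theorem DD_G1c (hF : bcvF m (ψ u) ≠ 0) (hψ : DV ψ u a ψ') (hX : DV X u a X') (hY : DV Y u a Y') :
    DD (fun q => G1 m l (ψ q) (X q) (Y q)) u a
      (dG1 m l (ψ u) ψ' (X u) (Y u) + G1 m l (ψ u) X' (Y u) + G1 m l (ψ u) (X u) Y') := by
  unfold G1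
  have hW := DD_Wc hF hψ
  have hx := DD_omc (l := l) hF hψ hX
  have hy := DD_omc (l := l) hF hψ hY
  refine DD.congr (((((DD.const _).mul (hW.mul (hψ 1))).mul (((hX 0).mul (hY 0)).sub ((hX 1).mul (hY 1)))).sub
    (((DD.const _).mul (hW.mul (hψ 0))).mul (((hX 0).mul (hY 1)).add ((hX 1).mul (hY 0))))).sub
    ((DD.const _).mul ((hx.mul (hY 0)).add (hy.mul (hX 0))))) ?_
  simp only [dG1]; ring

theorem DD_G2c (hF : bcvF m (ψ u) ≠ 0) (hψ : DV ψ u a ψ') (hX : DV X u a X') (hY : DV Y u a Y') :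
    DD (fun q => G2 m l (ψ q) (X q) (Y q)) u a
      (dG2 m l (ψ u) ψ' (X u) (Y u) + G2 m l (ψ u) X' (Y u) + G2 m l (ψ u) (X u) Y') := by
  unfold G2
  have hW := DD_Wc hF hψ
  have h0 := DD_G0c (l := l) hF hψ hX hY
  have h1 := DD_G1c (l := l) hF hψ hX hY
  refine DD.congr (((((DD.const _).mul (hW.mul (((hψ 1).mul h0).sub ((hψ 0).mul h1)))).neg).sub
    (((DD.const _).mul ((hW.mul hW).mul ((hψ 0).mul (hψ 1)))).mul (((hX 0).mul (hY 0)).sub ((hX 1).mul (hY 1))))).add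
    (((DD.const _).mul ((hW.mul hW).mul (((hψ 0).mul (hψ 0)).sub ((hψ 1).mul (hψ 1))))).mul (((hX 0).mul (hY 1)).add ((hX 1).mul (hY 0))))) ?_
  simp only [dG2]; ring

theorem DV_Gam (hF : bcvF m (ψ u) ≠ 0) (hψ : DV ψ u a ψ') (hX : DV X u a X') (hY : DV Y u a Y') :
    DV (fun q => Gam m l (ψ q) (X q) (Y q)) u a
      (fun k => dGam m l (ψ u) ψ' (X u) (Y u) k + Gam m l (ψ u) X' (Y u) k + Gam m l (ψ u) (X u) Y' k) := by
  intro k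
  fin_cases k
  · exact DD_G0c hF hψ hX hY
  · exact DD_G1c hF hψ hX hY
  · exact DD_G2c hF hψ hX hY
end chain

theorem DV_const {n : ℕ} (c : Pt 3) (u a : Pt n) : DV (fun _ => c) u a 0 := fun k => DD.const (c k)
theorem DV_id (u a : Pt 3) : DV (fun q => q) u a a := fun k => DD.coord k

theorem Gam_zero_left (m l : ℝ) (p v : Pt 3) : Gam m l p 0 v = 0 := by
  funext k; fin_cases k <;> simp [Gam, G0, G1, G2, bom]
theorem Gam_zero_right (m l : ℝ) (p v : Pt 3) : Gam m l p v 0 = 0 := by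
  funext k; fin_cases k <;> simp [Gam, G0, G1, G2, bom]

theorem isOpen_F (m : ℝ) (p : Pt 3) (h : bcvF m p ≠ 0) : ∀ᶠ q in nhds p, bcvF m q ≠ 0 :=
  (DD_F m p 0).1.continuousAt.eventually_ne h

theorem curv_eq {m : ℝ} (l : ℝ) {p : Pt 3} (h : bcvF m p ≠ 0) (v w z : Pt 3) (k : Fin 3) :
    curvPt (bcvMet m l) p v w z k =
      (dGam m l p v w z k + Gam m l p v (Gam m l p w z) k)
      - (dGam m l p w v z k + Gam m l p w (Gam m l p v z) k) := by
  have hc : ∀ w z : Pt 3, ∀ q, bcvF m q ≠ 0 →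
      cov (bcvMet m l) (fun _ => w) (fun _ => z) q = Gam m l q w z := by
    intro w z q hq
    funext k
    simp only [cov]
    rw [christ_sum l hq]
    simp
  have hcc : ∀ v w z : Pt 3, cov (bcvMet m l) (fun _ => v) (cov (bcvMet m l) (fun _ => w) (fun _ => z)) p k
      = dGam m l p v w z k + Gam m l p v (Gam m l p w z) k := by
    intro v w z
    rw [cov, christ_sum l h, hc w z p h]
    congr 1
    have e : (fun q => cov (bcvMet m l) (fun _ => w) (fun _ => z) q k) =ᶠ[nhds p] fun q => Gam m l q w z k := by
      filter_upwards [isOpen_F m p h] with q hq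
      rw [hc w z q hq]
    rw [e.fderiv_eq]
    have := (DV_Gam (l := l) (ψ := fun q => q) h (DV_id p v) (DV_const w p v) (DV_const z p v) k).2
    rw [Gam_zero_left, Gam_zero_right] at this
    simpa using this
  have hl : cov (bcvMet m l) (lieB (fun _ => v) (fun _ => w)) (fun _ => z) p k = 0 := by
    have : lieB (fun _ : Pt 3 => v) (fun _ => w) = fun _ => 0 := by
      funext q k; simp [lieB]
    rw [this, hc 0 z p h, Gam_zero_left]; rfl
  simp only [curvPt, curvOp, Pi.sub_apply]
  rw [hcc, hcc, hl]; ring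

/-- the third coordinate vector -/
def E3 : Pt 3 := ![0, 0, 1]

/-- curvature in closed form -/
def Rm (m l : ℝ) (p v w z : Pt 3) (k : Fin 3) : ℝ :=
  (4 * m - 3 * l ^ 2 / 4) * (gip (bcvMet m l) p w z * v k - gip (bcvMet m l) p v z * w k)
   - (4 * m - l ^ 2) * (bom m l p w * bom m l p z * v k - bom m l p v * bom m l p z * w k
      + (gip (bcvMet m l) p w z * bom m l p v - gip (bcvMet m l) p v z * bom m l p w) * E3 k)

theorem om_dGam (m l : ℝ) (p d u v : Pt 3) : bom m l p (dGam m l p d u v) =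
   -(l / 2 * (dW m p d * (p 1 * G0 m l p u v - p 0 * G1 m l p u v)
      + bW m p * (d 1 * G0 m l p u v - d 0 * G1 m l p u v)))
    - l * m * (2 * bW m p * dW m p d * (p 0 * p 1)
        + bW m p * bW m p * (d 0 * p 1 + p 0 * d 1)) * (u 0 * v 0 - u 1 * v 1)
    + l * m / 2 * (2 * bW m p * dW m p d * (p 0 * p 0 - p 1 * p 1)
        + bW m p * bW m p * (2 * p 0 * d 0 - 2 * p 1 * d 1)) * (u 0 * v 1 + u 1 * v 0) := by
  simp only [bom, dGam, dG2, Matrix.cons_val_zero, Matrix.cons_val_one, Matrix.cons_val]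
  ring

theorem Gam_0 (m l : ℝ) (p u v : Pt 3) : Gam m l p u v 0 = G0 m l p u v := rfl
theorem Gam_1 (m l : ℝ) (p u v : Pt 3) : Gam m l p u v 1 = G1 m l p u v := rfl
theorem dGam_0 (m l : ℝ) (p d u v : Pt 3) : dGam m l p d u v 0 = dG0 m l p d u v := rfl
theorem dGam_1 (m l : ℝ) (p d u v : Pt 3) : dGam m l p d u v 1 = dG1 m l p d u v := rfl

set_option maxHeartbeats 4000000 in
theorem Rm_0 {m : ℝ} (l : ℝ) {p : Pt 3} (h : bcvF m p ≠ 0) (v w z : Pt 3) :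
      (dGam m l p v w z 0 + Gam m l p v (Gam m l p w z) 0)
      - (dGam m l p w v z 0 + Gam m l p w (Gam m l p v z) 0) = Rm m l p v w z 0 := by
  have hE : E3 0 = 0 := rfl
  have hF : bcvF m p = 1 + m * (p 0 * p 0 + p 1 * p 1) := by unfold bcvF; ring
  have hW : bW m p = (1 + m * (p 0 * p 0 + p 1 * p 1))⁻¹ := by rw [← hF]; rfl
  rw [hF] at h
  simp only [Rm, gip_eq, Gam_0, dGam_0, dG0]
  rw [G0.eq_def m l p v, G0.eq_def m l p w (Gam m l p v z)]
  simp only [om_Gam, Gam_0, Gam_1, G0, G1, dom, dW, hE]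
  generalize h1 : bom m l p v = a
  generalize h2 : bom m l p w = b
  generalize h3 : bom m l p z = c
  generalize bW m p = W at *
  generalize p 0 = x at *
  generalize p 1 = y at *
  rw [hW]
  field_simp
  ring

set_option maxHeartbeats 4000000 in
theorem Rm_1 {m : ℝ} (l : ℝ) {p : Pt 3} (h : bcvF m p ≠ 0) (v w z : Pt 3) :
      (dGam m l p v w z 1 + Gam m l p v (Gam m l p w z) 1)
      - (dGam m l p w v z 1 + Gam m l p w (Gam m l p v z) 1) = Rm m l p v w z 1 := by
  have hE : E3 1 = 0 := rfl
  have hF : bcvF m p = 1 + m * (p 0 * p 0 + p 1 * p 1) := by unfold bcvF; ring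
  have hW : bW m p = (1 + m * (p 0 * p 0 + p 1 * p 1))⁻¹ := by rw [← hF]; rfl
  rw [hF] at h
  simp only [Rm, gip_eq, Gam_1, dGam_1, dG1]
  rw [G1.eq_def m l p v, G1.eq_def m l p w (Gam m l p v z)]
  simp only [om_Gam, Gam_0, Gam_1, G0, G1, dom, dW, hE]
  generalize h1 : bom m l p v = a
  generalize h2 : bom m l p w = b
  generalize h3 : bom m l p z = c
  generalize bW m p = W at *
  generalize p 0 = x at *
  generalize p 1 = y at *
  rw [hW]
  field_simp
  ring

theorem bom_E3 (m l : ℝ) (p : Pt 3) : bom m l p E3 = 1 := by simp [bom, E3]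

set_option maxHeartbeats 4000000 in
theorem Rm_om {m : ℝ} (l : ℝ) {p : Pt 3} (h : bcvF m p ≠ 0) (v w z : Pt 3) :
      (bom m l p (dGam m l p v w z) + bom m l p (Gam m l p v (Gam m l p w z)))
      - (bom m l p (dGam m l p w v z) + bom m l p (Gam m l p w (Gam m l p v z))) =
  (4 * m - 3 * l ^ 2 / 4) * (gip (bcvMet m l) p w z * bom m l p v - gip (bcvMet m l) p v z * bom m l p w)
   - (4 * m - l ^ 2) * ((gip (bcvMet m l) p w z * bom m l p v - gip (bcvMet m l) p v z * bom m l p w)) := by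
  have hF : bcvF m p = 1 + m * (p 0 ^ 2 + p 1 ^ 2) := by unfold bcvF; ring
  have hW : bW m p = (1 + m * (p 0 ^ 2 + p 1 ^ 2))⁻¹ := by rw [← hF]; rfl
  rw [hF] at h
  simp only [om_dGam, om_Gam, gip_eq, Gam_0, Gam_1, G0, G1, dW]
  generalize h1 : bom m l p v = a
  generalize h2 : bom m l p w = b
  generalize h3 : bom m l p z = c
  generalize bW m p = W at *
  generalize p 0 = x at *
  generalize p 1 = y at *
  rw [hW]
  field_simp
  ring

theorem curv_Rm {m : ℝ} (l : ℝ) {p : Pt 3} (h : bcvF m p ≠ 0) (v w z : Pt 3) (k : Fin 3) :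
    curvPt (bcvMet m l) p v w z k = Rm m l p v w z k := by
  rw [curv_eq l h]
  have h0 := Rm_0 l h v w z
  have h1 := Rm_1 l h v w z
  fin_cases k
  · exact h0
  · exact h1
  · have h2 := Rm_om l h v w z
    show (dGam m l p v w z 2 + Gam m l p v (Gam m l p w z) 2)
      - (dGam m l p w v z 2 + Gam m l p w (Gam m l p v z) 2) = Rm m l p v w z 2
    have hb : ∀ x : Pt 3, bom m l p x = x 2 + l / 2 * (bW m p * (p 1 * x 0 - p 0 * x 1)) := fun x => rfl
    rw [hb (dGam m l p v w z), hb (dGam m l p w v z), hb (Gam m l p v (Gam m l p w z)),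
      hb (Gam m l p w (Gam m l p v z))] at h2
    unfold Rm at *
    have hE0 : E3 0 = 0 := rfl
    have hE1 : E3 1 = 0 := rfl
    have hE2 : E3 2 = 1 := rfl
    rw [hE0] at h0
    rw [hE1] at h1
    rw [hE2]
    have ev := hb v
    have ew := hb w
    linear_combination h2 - l / 2 * bW m p * p 1 * h0 + l / 2 * bW m p * p 0 * h1 + 
      ((4 * m - 3 * l ^ 2 / 4) * gip (bcvMet m l) p w z - (4 * m - l ^ 2) * bom m l p w * bom m l p z ) * ev
      - ((4 * m - 3 * l ^ 2 / 4) * gip (bcvMet m l) p v z - (4 * m - l ^ 2) * bom m l p v * bom m l p z ) * ew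

/-- smooth vector field along -/
def SV (X : Pt 2 → Pt 3) : Prop := ∀ k, ContDiff ℝ (⊤ : ℕ∞) fun u => X u k

/-- basis vectors -/
abbrev bs (a : Fin 2) : Pt 2 := Pi.single a 1

theorem SV.dv {X : Pt 2 → Pt 3} (h : SV X) (u : Pt 2) (a : Fin 2) : DV X u (bs a) (dmap X u a) :=
  fun k => ⟨(h k).differentiable (by simp) u, rfl⟩

theorem smooth_dd {f : Pt 2 → ℝ} (h : ContDiff ℝ (⊤ : ℕ∞) f) (u : Pt 2) (a : Fin 2) :
    DD f u (bs a) (fderiv ℝ f u (bs a)) := ⟨h.differentiable (by simp) u, rfl⟩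

theorem smooth_fd {f : Pt 2 → ℝ} (h : ContDiff ℝ (⊤ : ℕ∞) f) (a : Fin 2) :
    ContDiff ℝ (⊤ : ℕ∞) fun u => fderiv ℝ f u (bs a) :=
  (h.fderiv_right (m := (⊤ : ℕ∞)) (by simp)).clm_apply contDiff_const

theorem SV.dmap {X : Pt 2 → Pt 3} (h : SV X) (a : Fin 2) : SV (fun u => dmap X u a) :=
  fun k => smooth_fd (h k) a

theorem fd_symm {f : Pt 2 → ℝ} (h : ContDiff ℝ (⊤ : ℕ∞) f) (u : Pt 2) (a b : Fin 2) :
    fderiv ℝ (fun q => fderiv ℝ f q (bs b)) u (bs a)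
      = fderiv ℝ (fun q => fderiv ℝ f q (bs a)) u (bs b) := by
  have hd : DifferentiableAt ℝ (fderiv ℝ f) u :=
    ((h.fderiv_right (m := (⊤ : ℕ∞)) (by simp)).differentiable (by simp)) u
  have e : ∀ v w : Pt 2, fderiv ℝ (fun q => fderiv ℝ f q v) u w = fderiv ℝ (fderiv ℝ f) u w v := by
    intro v w
    have := (hd.hasFDerivAt.clm_apply (hasFDerivAt_const v u)).fderiv
    rw [this]; simp
  rw [e, e]
  exact (h.contDiffAt.isSymmSndFDerivAt (by rw [minSmoothness_of_isRCLikeNormedField]; exact WithTop.coe_le_coe.2 (le_top : (2 : ℕ∞) ≤ ⊤))) _ _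

theorem dmap_symm {X : Pt 2 → Pt 3} (h : SV X) (u : Pt 2) (a b : Fin 2) :
    dmap (fun q => dmap X q b) u a = dmap (fun q => dmap X q a) u b := by
  funext k
  exact fd_symm (h k) u a b

section lin
variable (m l : ℝ) (p u u' v v' : Pt 3) (c : ℝ)
theorem gip_symm : gip (bcvMet m l) p u v = gip (bcvMet m l) p v u := by
  rw [gip_eq, gip_eq]; ring
theorem gip_add_left : gip (bcvMet m l) p (u + u') v
    = gip (bcvMet m l) p u v + gip (bcvMet m l) p u' v := by
  simp only [gip_eq, bom, Pi.add_apply]; ring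
theorem gip_smul_left : gip (bcvMet m l) p (c • u) v = c * gip (bcvMet m l) p u v := by
  simp only [gip_eq, bom, Pi.smul_apply, smul_eq_mul]; ring
theorem gip_sub_left : gip (bcvMet m l) p (u - u') v
    = gip (bcvMet m l) p u v - gip (bcvMet m l) p u' v := by
  simp only [gip_eq, bom, Pi.sub_apply]; ring
theorem gip_neg_left : gip (bcvMet m l) p (-u) v = - gip (bcvMet m l) p u v := by
  simp only [gip_eq, bom, Pi.neg_apply]; ring
theorem gip_zero_left : gip (bcvMet m l) p 0 v = 0 := by
  simp [gip_eq, bom]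
theorem gip_add_right : gip (bcvMet m l) p v (u + u')
    = gip (bcvMet m l) p v u + gip (bcvMet m l) p v u' := by
  simp only [gip_eq, bom, Pi.add_apply]; ring
theorem gip_smul_right : gip (bcvMet m l) p v (c • u) = c * gip (bcvMet m l) p v u := by
  simp only [gip_eq, bom, Pi.smul_apply, smul_eq_mul]; ring
theorem gip_E3 : gip (bcvMet m l) p v E3 = bom m l p v := by
  rw [gip_eq, bom_E3]; simp [E3]
theorem Gam_symm : Gam m l p u v = Gam m l p v u := by
  funext k; fin_cases k <;> simp [Gam, G0, G1, G2, bom] <;> ring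
theorem Gam_add_right : Gam m l p u (v + v') = Gam m l p u v + Gam m l p u v' := by
  funext k; fin_cases k <;> simp [Gam, G0, G1, G2, bom] <;> ring
theorem Gam_smul_right : Gam m l p u (c • v) = c • Gam m l p u v := by
  funext k; fin_cases k <;> simp [Gam, G0, G1, G2, bom] <;> ring
theorem dgip_symm : dgip m l p u v v' = dgip m l p u v' v := by
  simp only [dgip]; ring
variable {m p}
theorem gip_pos (h : bcvF m p ≠ 0) (hv : v ≠ 0) : 0 < gip (bcvMet m l) p v v := by
  have hW : 0 < bW m p * bW m p := mul_self_pos.2 (inv_ne_zero h)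
  rw [gip_eq]
  by_contra hc
  push Not at hc
  have h0 := mul_self_nonneg (bom m l p v)
  have h1 : 0 ≤ bW m p * bW m p * (v 0 * v 0 + v 1 * v 1) := by
    have := mul_self_nonneg (v 0)
    have := mul_self_nonneg (v 1)
    positivity
  have h2 : bW m p * bW m p * (v 0 * v 0 + v 1 * v 1) = 0 := by linarith
  have h3 : bom m l p v = 0 := by
    have : bom m l p v * bom m l p v = 0 := by linarith
    exact mul_self_eq_zero.1 this
  have h4 : v 0 * v 0 + v 1 * v 1 = 0 := (mul_eq_zero.1 h2).resolve_left hW.ne'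
  have e0 : v 0 = 0 := by nlinarith [mul_self_nonneg (v 0), mul_self_nonneg (v 1)]
  have e1 : v 1 = 0 := by nlinarith [mul_self_nonneg (v 0), mul_self_nonneg (v 1)]
  have e2 : v 2 = 0 := by simpa [bom, e0, e1] using h3
  apply hv
  funext k; fin_cases k
  · exact e0
  · exact e1
  · exact e2
theorem dgip_compat (h : bcvF m p ≠ 0) (z : Pt 3) : dgip m l p u v z =
    gip (bcvMet m l) p (Gam m l p u v) z + gip (bcvMet m l) p v (Gam m l p u z) := by
  rw [gip_symm m l p v, ← koszul l h, ← koszul l h, dgip_symm m l p v u z, dgip_symm m l p z u v,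
    dgip_symm m l p u z v]
  ring
end lin

section along
variable {m l : ℝ} {φ : Pt 2 → Pt 3}

theorem covA (hdom : ∀ u, 0 < bcvF m (φ u)) (V : Pt 2 → Pt 3) (a : Fin 2) (u : Pt 2) :
    covAlong (bcvMet m l) φ V a u = dmap V u a + Gam m l (φ u) (dmap φ u a) (V u) := by
  funext k
  rw [covAlong, christ_sum l (hdom u).ne']
  rfl

theorem compat (hφ : SV φ) (hdom : ∀ u, 0 < bcvF m (φ u)) {X Y : Pt 2 → Pt 3} (hX : SV X) (hY : SV Y)
    (a : Fin 2) (u : Pt 2) :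
    fderiv ℝ (fun q => gip (bcvMet m l) (φ q) (X q) (Y q)) u (bs a)
      = gip (bcvMet m l) (φ u) (covAlong (bcvMet m l) φ X a u) (Y u)
        + gip (bcvMet m l) (φ u) (X u) (covAlong (bcvMet m l) φ Y a u) := by
  rw [(DD_gipc (hdom u).ne' (hφ.dv u a) (hX.dv u a) (hY.dv u a)).2, covA hdom, covA hdom,
    dgip_compat l _ _ (hdom u).ne', gip_add_left, gip_add_right]
  ring

theorem cov_symm (hφ : SV φ) (hdom : ∀ u, 0 < bcvF m (φ u)) (a b : Fin 2) (u : Pt 2) :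
    covAlong (bcvMet m l) φ (fun q => dmap φ q b) a u
      = covAlong (bcvMet m l) φ (fun q => dmap φ q a) b u := by
  rw [covA hdom, covA hdom, dmap_symm hφ, Gam_symm]

theorem SV_Gam (hφ : SV φ) (hdom : ∀ u, 0 < bcvF m (φ u)) {X Y : Pt 2 → Pt 3} (hX : SV X) (hY : SV Y) :
    SV (fun u => Gam m l (φ u) (X u) (Y u)) := by
  have hW : ContDiff ℝ (⊤ : ℕ∞) fun u => bW m (φ u) := by
    unfold bW
    refine ContDiff.inv ?_ (fun u => (hdom u).ne')
    unfold bcvF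
    have := hφ 0
    have := hφ 1
    fun_prop
  have p0 := hφ 0
  have p1 := hφ 1
  have x0 := hX 0
  have x1 := hX 1
  have x2 := hX 2
  have y0 := hY 0
  have y1 := hY 1
  have y2 := hY 2
  have ox : ContDiff ℝ (⊤ : ℕ∞) fun u => bom m l (φ u) (X u) := by unfold bom; fun_prop
  have oy : ContDiff ℝ (⊤ : ℕ∞) fun u => bom m l (φ u) (Y u) := by unfold bom; fun_prop
  have g0 : ContDiff ℝ (⊤ : ℕ∞) fun u => G0 m l (φ u) (X u) (Y u) := by unfold G0; fun_prop
  have g1 : ContDiff ℝ (⊤ : ℕ∞) fun u => G1 m l (φ u) (X u) (Y u) := by unfold G1; fun_prop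
  have g2 : ContDiff ℝ (⊤ : ℕ∞) fun u => G2 m l (φ u) (X u) (Y u) := by unfold G2; fun_prop
  intro k
  fin_cases k
  · exact g0
  · exact g1
  · exact g2

theorem SV_add {X Y : Pt 2 → Pt 3} (hX : SV X) (hY : SV Y) : SV (fun u => X u + Y u) :=
  fun k => (hX k).add (hY k)

theorem SV_smul {f : Pt 2 → ℝ} (hf : ContDiff ℝ (⊤ : ℕ∞) f) {X : Pt 2 → Pt 3} (hX : SV X) :
    SV (fun u => f u • X u) := fun k => hf.mul (hX k)

theorem SV_cov (hφ : SV φ) (hdom : ∀ u, 0 < bcvF m (φ u)) {V : Pt 2 → Pt 3} (hV : SV V) (a : Fin 2) :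
    SV (covAlong (bcvMet m l) φ V a) := by
  have : covAlong (bcvMet m l) φ V a = fun u => dmap V u a + Gam m l (φ u) (dmap φ u a) (V u) := by
    funext u; exact covA hdom V a u
  rw [this]
  exact SV_add (hV.dmap a) (SV_Gam hφ hdom (hφ.dmap a) hV)

theorem smooth_gip (hφ : SV φ) (hdom : ∀ u, 0 < bcvF m (φ u)) {X Y : Pt 2 → Pt 3} (hX : SV X) (hY : SV Y) :
    ContDiff ℝ (⊤ : ℕ∞) fun u => gip (bcvMet m l) (φ u) (X u) (Y u) := by
  have p0 := hφ 0
  have p1 := hφ 1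
  have hW : ContDiff ℝ (⊤ : ℕ∞) fun u => bW m (φ u) := by
    unfold bW
    refine ContDiff.inv ?_ (fun u => (hdom u).ne')
    unfold bcvF
    fun_prop
  have x0 := hX 0
  have x1 := hX 1
  have x2 := hX 2
  have y0 := hY 0
  have y1 := hY 1
  have y2 := hY 2
  simp only [gip_eq, bom]
  fun_prop

theorem dmap_add {X Y : Pt 2 → Pt 3} (hX : SV X) (hY : SV Y) (u : Pt 2) (a : Fin 2) :
    dmap (fun q => X q + Y q) u a = dmap X u a + dmap Y u a := by
  funext k
  exact (((hX.dv u a) k).add ((hY.dv u a) k)).2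

theorem dmap_smul {f : Pt 2 → ℝ} (hf : ContDiff ℝ (⊤ : ℕ∞) f) {X : Pt 2 → Pt 3} (hX : SV X)
    (u : Pt 2) (a : Fin 2) :
    dmap (fun q => f q • X q) u a = fderiv ℝ f u (bs a) • X u + f u • dmap X u a := by
  funext k
  exact ((smooth_dd hf u a).mul ((hX.dv u a) k)).2

theorem cov_add (hdom : ∀ u, 0 < bcvF m (φ u)) {X Y : Pt 2 → Pt 3} (hX : SV X) (hY : SV Y)
    (a : Fin 2) (u : Pt 2) :
    covAlong (bcvMet m l) φ (fun q => X q + Y q) a u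
      = covAlong (bcvMet m l) φ X a u + covAlong (bcvMet m l) φ Y a u := by
  rw [covA hdom, covA hdom, covA hdom, dmap_add hX hY, Gam_add_right]; abel

theorem cov_smul (hdom : ∀ u, 0 < bcvF m (φ u)) {f : Pt 2 → ℝ} (hf : ContDiff ℝ (⊤ : ℕ∞) f)
    {X : Pt 2 → Pt 3} (hX : SV X) (a : Fin 2) (u : Pt 2) :
    covAlong (bcvMet m l) φ (fun q => f q • X q) a u
      = fderiv ℝ f u (bs a) • X u + f u • covAlong (bcvMet m l) φ X a u := by
  rw [covA hdom, covA hdom, dmap_smul hf hX, Gam_smul_right]; module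

theorem ricci_id (hφ : SV φ) (hdom : ∀ u, 0 < bcvF m (φ u)) {V : Pt 2 → Pt 3} (hV : SV V)
    (a b : Fin 2) (u : Pt 2) (k : Fin 3) :
    covAlong (bcvMet m l) φ (covAlong (bcvMet m l) φ V b) a u k
      - covAlong (bcvMet m l) φ (covAlong (bcvMet m l) φ V a) b u k
      = Rm m l (φ u) (dmap φ u a) (dmap φ u b) (V u) k := by
  rw [← curv_Rm l (hdom u).ne', curv_eq l (hdom u).ne']
  have key : ∀ a b : Fin 2, covAlong (bcvMet m l) φ (covAlong (bcvMet m l) φ V b) a u k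
      = dmap (fun q => dmap V q b) u a k + (dGam m l (φ u) (dmap φ u a) (dmap φ u b) (V u) k
          + Gam m l (φ u) (dmap (fun q => dmap φ q b) u a) (V u) k
          + Gam m l (φ u) (dmap φ u b) (dmap V u a) k)
        + (Gam m l (φ u) (dmap φ u a) (dmap V u b) k
          + Gam m l (φ u) (dmap φ u a) (Gam m l (φ u) (dmap φ u b) (V u)) k) := by
    intro a b
    have : covAlong (bcvMet m l) φ V b = fun u => dmap V u b + Gam m l (φ u) (dmap φ u b) (V u) := by
      funext u; exact covA hdom V b u
    rw [this, covA hdom, dmap_add (hV.dmap b) (SV_Gam hφ hdom (hφ.dmap b) hV), Gam_add_right]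
    have h2 := (DV_Gam (m := m) (l := l) (hdom u).ne' (hφ.dv u a) ((hφ.dmap b).dv u a) (hV.dv u a) k).2
    simp only [Pi.add_apply]
    rw [show dmap (fun u => Gam m l (φ u) (dmap φ u b) (V u)) u a k = _ from h2]
  rw [key a b, key b a, dmap_symm hV u a b, dmap_symm hφ u a b]
  ring
end along

section geom
variable {m l : ℝ} {φ ξ : Pt 2 → Pt 3}

theorem fff_symm (u : Pt 2) (a b : Fin 2) : fff (bcvMet m l) φ u a b = fff (bcvMet m l) φ u b a := by
  simp only [fff, Matrix.of_apply]; exact gip_symm _ _ _ _ _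

theorem fff_apply (u : Pt 2) (a b : Fin 2) :
    fff (bcvMet m l) φ u a b = gip (bcvMet m l) (φ u) (dmap φ u a) (dmap φ u b) := rfl

theorem fff_det (hdom : ∀ u, 0 < bcvF m (φ u)) (hli : ∀ u, LinearIndependent ℝ (dmap φ u)) (u : Pt 2) :
    IsUnit (fff (bcvMet m l) φ u).det := by
  rw [isUnit_iff_ne_zero]
  intro h0
  obtain ⟨v, hv, hv0⟩ := Matrix.exists_mulVec_eq_zero_iff.2 h0
  have e : ∀ a, fff (bcvMet m l) φ u a 0 * v 0 + fff (bcvMet m l) φ u a 1 * v 1 = 0 := by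
    intro a
    have := congrFun hv0 a
    simpa [Matrix.mulVec, dotProduct, Fin.sum_univ_two] using this
  have hX : v 0 • dmap φ u 0 + v 1 • dmap φ u 1 ≠ 0 := by
    intro hX
    apply hv
    have := Fintype.linearIndependent_iff.1 (hli u) v (by rw [Fin.sum_univ_two]; exact hX)
    funext i; exact this i
  have := gip_pos l _ (hdom u).ne' hX
  simp only [gip_add_left, gip_add_right, gip_smul_left, gip_smul_right, ← fff_apply] at this
  have e0 := e 0
  have e1 := e 1
  apply this.ne'
  rw [fff_symm u 0 1] at e0 ⊢
  linear_combination v 0 * e0 + v 1 * e1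

theorem fff_inv (hdom : ∀ u, 0 < bcvF m (φ u)) (hli : ∀ u, LinearIndependent ℝ (dmap φ u)) (u : Pt 2)
    (a b : Fin 2) :
    (fff (bcvMet m l) φ u)⁻¹ a 0 * fff (bcvMet m l) φ u 0 b
      + (fff (bcvMet m l) φ u)⁻¹ a 1 * fff (bcvMet m l) φ u 1 b = if a = b then 1 else 0 := by
  have := congrFun (congrFun (Matrix.nonsing_inv_mul _ (fff_det (l := l) hdom hli u)) a) b
  simpa [Matrix.mul_apply, Fin.sum_univ_two, Matrix.one_apply] using this

theorem fff_inv_symm (u : Pt 2) (a b : Fin 2) :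
    (fff (bcvMet m l) φ u)⁻¹ a b = (fff (bcvMet m l) φ u)⁻¹ b a := by
  have : (fff (bcvMet m l) φ u).transpose = fff (bcvMet m l) φ u := by
    ext a b; exact fff_symm u b a
  conv_lhs => rw [← this, ← Matrix.transpose_nonsing_inv]
  rfl

theorem span_zero (hdom : ∀ u, 0 < bcvF m (φ u)) (hli : ∀ u, LinearIndependent ℝ (dmap φ u))
    (hξ : IsUnitNormal (bcvMet m l) φ ξ) (u : Pt 2) (X : Pt 3)
    (h1 : ∀ a, gip (bcvMet m l) (φ u) X (dmap φ u a) = 0) (h2 : gip (bcvMet m l) (φ u) X (ξ u) = 0) :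
    X = 0 := by
  by_contra hX
  have hpos := gip_pos l X (hdom u).ne' hX
  let f : Fin 3 → Pt 3 := ![dmap φ u 0, dmap φ u 1, ξ u]
  have hf : LinearIndependent ℝ f := by
    rw [Fintype.linearIndependent_iff]
    intro c hc
    rw [Fin.sum_univ_three] at hc
    change c 0 • dmap φ u 0 + c 1 • dmap φ u 1 + c 2 • ξ u = 0 at hc
    have hn := fun a => hξ.2.2 u a
    have c2 : c 2 = 0 := by
      have := congrArg (fun v => gip (bcvMet m l) (φ u) (ξ u) v) hc
      simp only [gip_add_right, gip_smul_right, hn, hξ.2.1] at this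
      rw [gip_symm, gip_zero_left] at this
      linarith
    rw [c2, zero_smul, add_zero] at hc
    have := Fintype.linearIndependent_iff.1 (hli u) ![c 0, c 1] (by rw [Fin.sum_univ_two]; exact hc)
    intro i; fin_cases i
    · exact this 0
    · exact this 1
    · exact c2
  have hs : Submodule.span ℝ (Set.range f) = ⊤ := hf.span_eq_top_of_card_eq_finrank (by simp)
  have hmem : X ∈ Submodule.span ℝ (Set.range f) := by rw [hs]; trivial
  have : ∀ Y ∈ Submodule.span ℝ (Set.range f), gip (bcvMet m l) (φ u) X Y = 0 := by
    intro Y hY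
    induction hY using Submodule.span_induction with
    | mem x hx =>
      obtain ⟨i, rfl⟩ := hx
      fin_cases i
      · exact h1 0
      · exact h1 1
      · exact h2
    | zero => rw [gip_symm, gip_zero_left]
    | add x y _ _ hx hy => rw [gip_add_right, hx, hy, add_zero]
    | smul a x _ hx => rw [gip_smul_right, hx, mul_zero]
  exact hpos.ne' (this X hmem)

theorem sff_eq (u : Pt 2) (a b : Fin 2) : sff (bcvMet m l) φ ξ u a b
    = gip (bcvMet m l) (φ u) (covAlong (bcvMet m l) φ (fun q => dmap φ q b) a u) (ξ u) := rfl

theorem koszul2 (hφ : SV φ) (hdom : ∀ u, 0 < bcvF m (φ u)) (u : Pt 2) (a b d : Fin 2) :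
    fderiv ℝ (fun q => fff (bcvMet m l) φ q b d) u (bs a)
      + fderiv ℝ (fun q => fff (bcvMet m l) φ q a d) u (bs b)
      - fderiv ℝ (fun q => fff (bcvMet m l) φ q a b) u (bs d)
    = 2 * gip (bcvMet m l) (φ u) (covAlong (bcvMet m l) φ (fun q => dmap φ q b) a u) (dmap φ u d) := by
  have h : ∀ a b d : Fin 2, fderiv ℝ (fun q => fff (bcvMet m l) φ q b d) u (bs a) = _ :=
    fun a b d => compat hφ hdom (hφ.dmap b) (hφ.dmap d) a u
  rw [h, h, h, cov_symm hφ hdom b a u, cov_symm hφ hdom d a u, cov_symm hφ hdom d b u,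
    gip_symm m l _ (dmap φ u b), gip_symm m l _ (dmap φ u a)]
  ring

theorem gauss (hφ : SV φ) (hdom : ∀ u, 0 < bcvF m (φ u)) (hli : ∀ u, LinearIndependent ℝ (dmap φ u))
    (hξ : IsUnitNormal (bcvMet m l) φ ξ) (u : Pt 2) (a b : Fin 2) :
    covAlong (bcvMet m l) φ (fun q => dmap φ q b) a u
      = christoffel (fff (bcvMet m l) φ) u 0 a b • dmap φ u 0
        + christoffel (fff (bcvMet m l) φ) u 1 a b • dmap φ u 1
        + sff (bcvMet m l) φ ξ u a b • ξ u := by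
  rw [← sub_eq_zero]
  apply span_zero hdom hli hξ u
  · intro d
    simp only [gip_sub_left, gip_add_left, gip_smul_left, hξ.2.2, ← fff_apply]
    simp only [christoffel, koszul2 hφ hdom, Fin.sum_univ_two]
    have i0 := fff_inv (l := l) hdom hli u 0
    have i1 := fff_inv (l := l) hdom hli u 1
    have s := fff_inv_symm (m := m) (l := l) (φ := φ) u 0 1
    have s' := fff_symm (m := m) (l := l) (φ := φ) u 0 1
    have i00 := i0 0
    have i01 := i0 1
    have i10 := i1 0
    have i11 := i1 1
    simp only [if_true, if_false, Fin.isValue, zero_ne_one, one_ne_zero] at i00 i01 i10 i11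
    generalize hA : gip (bcvMet m l) (φ u) (covAlong (bcvMet m l) φ (fun q => dmap φ q b) a u) (dmap φ u 0) = A
    generalize hB : gip (bcvMet m l) (φ u) (covAlong (bcvMet m l) φ (fun q => dmap φ q b) a u) (dmap φ u 1) = B
    fin_cases d
    · simp only [Fin.zero_eta, hA]
      rw [s] at *
      rw [s'] at *
      linear_combination -A * i00 - B * i10
    · simp only [Fin.mk_one, hB]
      rw [s] at *
      rw [s'] at *
      linear_combination -A * i01 - B * i11
  · have hn : ∀ a, gip (bcvMet m l) (φ u) (dmap φ u a) (ξ u) = 0 := fun a => by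
      rw [gip_symm]; exact hξ.2.2 u a
    simp only [gip_sub_left, gip_add_left, gip_smul_left, hξ.2.1, hn, sff_eq]
    ring

theorem fff_pos (hdom : ∀ u, 0 < bcvF m (φ u)) (hli : ∀ u, LinearIndependent ℝ (dmap φ u)) (u : Pt 2)
    (a : Fin 2) : 0 < fff (bcvMet m l) φ u a a :=
  gip_pos l _ (hdom u).ne' ((hli u).ne_zero a)

theorem lam_smooth (hφ : SV φ) (hdom : ∀ u, 0 < bcvF m (φ u)) (hli : ∀ u, LinearIndependent ℝ (dmap φ u))
    (hξ : IsUnitNormal (bcvMet m l) φ ξ) {lam : Pt 2 → ℝ}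
    (hl : ∀ u a b, sff (bcvMet m l) φ ξ u a b = lam u * fff (bcvMet m l) φ u a b) :
    ContDiff ℝ (⊤ : ℕ∞) lam := by
  have e : lam = fun u => sff (bcvMet m l) φ ξ u 0 0 / fff (bcvMet m l) φ u 0 0 := by
    funext u
    rw [hl, mul_div_cancel_right₀ _ (fff_pos hdom hli u 0).ne']
  rw [e]
  refine ContDiff.div ?_ ?_ (fun u => (fff_pos hdom hli u 0).ne')
  · exact smooth_gip hφ hdom (SV_cov hφ hdom (hφ.dmap 0) 0) hξ.1
  · exact smooth_gip hφ hdom (hφ.dmap 0) (hφ.dmap 0)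

theorem weingarten (hφ : SV φ) (hdom : ∀ u, 0 < bcvF m (φ u)) (hli : ∀ u, LinearIndependent ℝ (dmap φ u))
    (hξ : IsUnitNormal (bcvMet m l) φ ξ) {lam : Pt 2 → ℝ}
    (hl : ∀ u a b, sff (bcvMet m l) φ ξ u a b = lam u * fff (bcvMet m l) φ u a b) (a : Fin 2) (u : Pt 2) :
    covAlong (bcvMet m l) φ ξ a u = (-lam u) • dmap φ u a := by
  rw [← sub_eq_zero]
  apply span_zero hdom hli hξ u
  · intro b
    have h := compat (m := m) (l := l) hφ hdom hξ.1 (hφ.dmap b) a u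
    simp only [hξ.2.2] at h
    rw [gip_symm m l _ (ξ u), ← sff_eq, hl] at h
    simp only [fderiv_fun_const, Pi.zero_apply, zero_apply] at h
    rw [gip_sub_left, gip_smul_left, ← fff_apply]
    linarith
  · have h := compat (m := m) (l := l) hφ hdom hξ.1 hξ.1 a u
    simp only [hξ.2.1] at h
    rw [gip_symm m l _ (ξ u)] at h
    simp only [fderiv_fun_const, Pi.zero_apply, zero_apply] at h
    rw [gip_sub_left, gip_smul_left, gip_symm m l _ (dmap φ u a), hξ.2.2]
    linarith

theorem trace_two (hdom : ∀ u, 0 < bcvF m (φ u)) (hli : ∀ u, LinearIndependent ℝ (dmap φ u)) (u : Pt 2) :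
    ∑ a, ∑ b, (fff (bcvMet m l) φ u)⁻¹ a b * fff (bcvMet m l) φ u a b = 2 := by
  have i0 := fff_inv (l := l) hdom hli u 0 0
  have i1 := fff_inv (l := l) hdom hli u 1 1
  simp only [if_true] at i0 i1
  simp only [Fin.sum_univ_two]
  rw [fff_symm u 0 1] at *
  linarith [fff_symm (m := m) (l := l) (φ := φ) u 0 1]

theorem tension_eq (hφ : SV φ) (hdom : ∀ u, 0 < bcvF m (φ u)) (hli : ∀ u, LinearIndependent ℝ (dmap φ u))
    (hξ : IsUnitNormal (bcvMet m l) φ ξ) {lam : Pt 2 → ℝ}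
    (hl : ∀ u a b, sff (bcvMet m l) φ ξ u a b = lam u * fff (bcvMet m l) φ u a b) :
    tension (bcvMet m l) φ = fun u => (2 * lam u) • ξ u := by
  funext u k
  have h : ∀ a b, (fderiv ℝ (fun q => dmap φ q b k) u (Pi.single a 1)
      - ∑ c, christoffel (fff (bcvMet m l) φ) u c a b * dmap φ u c k
      + ∑ i, ∑ j, christoffel (bcvMet m l) (φ u) k i j * dmap φ u a i * dmap φ u b j)
      = fff (bcvMet m l) φ u a b * (lam u * ξ u k) := by
    intro a b
    have := congrFun (gauss hφ hdom hli hξ u a b) k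
    rw [hl] at this
    simp only [covAlong, Pi.add_apply, Pi.smul_apply, smul_eq_mul] at this
    rw [Fin.sum_univ_two]
    linear_combination this
  simp only [tension, h, ← mul_assoc]
  simp only [← Finset.sum_mul]
  rw [trace_two hdom hli]
  rfl

theorem meanCurv_eq (hdom : ∀ u, 0 < bcvF m (φ u)) (hli : ∀ u, LinearIndependent ℝ (dmap φ u))
    {lam : Pt 2 → ℝ}
    (hl : ∀ u a b, sff (bcvMet m l) φ ξ u a b = lam u * fff (bcvMet m l) φ u a b) (u : Pt 2) :
    meanCurv (bcvMet m l) φ ξ u = lam u := by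
  have := trace_two (l := l) hdom hli u
  simp only [meanCurv, shapeOp, hl, Fin.sum_univ_two] at *
  rw [fff_symm u 1 0] at this ⊢
  push_cast
  linear_combination (lam u / 2) * this
end geom

section final
variable {m l : ℝ} {φ ξ : Pt 2 → Pt 3}

theorem gip_Gam_E3 (h : ∀ u, 0 < bcvF m (φ u)) (u : Pt 2) (v : Pt 3) :
    gip (bcvMet m l) (φ u) (Gam m l (φ u) v E3) v = 0 := by
  rw [← koszul l (h u).ne', dgip_symm m l (φ u) v E3 v]
  simp [dgip, dom, dW, E3]

theorem Gam_E3_E3 (p : Pt 3) : Gam m l p E3 E3 = 0 := by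
  funext k; fin_cases k <;> simp [Gam, G0, G1, G2, bom, E3]

theorem codazzi (hφ : SV φ) (hdom : ∀ u, 0 < bcvF m (φ u)) (hli : ∀ u, LinearIndependent ℝ (dmap φ u))
    (hξ : IsUnitNormal (bcvMet m l) φ ξ) {lam : Pt 2 → ℝ}
    (hl : ∀ u a b, sff (bcvMet m l) φ ξ u a b = lam u * fff (bcvMet m l) φ u a b) (u : Pt 2) (a : Fin 2) :
    fderiv ℝ lam u (bs a) = -(4 * m - l ^ 2) * bom m l (φ u) (ξ u) * bom m l (φ u) (dmap φ u a) := by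
  have hs := lam_smooth hφ hdom hli hξ hl
  have hw : ∀ b, covAlong (bcvMet m l) φ ξ b = fun u => (-lam u) • dmap φ u b :=
    fun b => funext fun u => weingarten hφ hdom hli hξ hl b u
  have hD : ∀ a b, covAlong (bcvMet m l) φ (covAlong (bcvMet m l) φ ξ b) a u
      = (-fderiv ℝ lam u (bs a)) • dmap φ u b
        + (-lam u) • covAlong (bcvMet m l) φ (fun q => dmap φ q b) a u := by
    intro a b
    rw [hw, cov_smul hdom hs.neg (hφ.dmap b)]
    congr 2
    exact (smooth_dd hs u a).neg.2
  have hn : ∀ a, gip (bcvMet m l) (φ u) (dmap φ u a) (ξ u) = 0 := fun a => by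
    rw [gip_symm]; exact hξ.2.2 u a
  have key : (fderiv ℝ lam u (bs 1) + (4 * m - l ^ 2) * bom m l (φ u) (ξ u) * bom m l (φ u) (dmap φ u 1)) • dmap φ u 0
     + (-(fderiv ℝ lam u (bs 0) + (4 * m - l ^ 2) * bom m l (φ u) (ξ u) * bom m l (φ u) (dmap φ u 0))) • dmap φ u 1 = 0 := by
    funext k
    have h := ricci_id (l := l) hφ hdom hξ.1 0 1 u k
    rw [hD, hD, cov_symm hφ hdom 0 1 u] at h
    simp only [Rm, hn, Pi.add_apply, Pi.smul_apply, smul_eq_mul] at h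
    simp only [Pi.add_apply, Pi.smul_apply, smul_eq_mul, Pi.zero_apply]
    linear_combination h
  have := Fintype.linearIndependent_iff.1 (hli u) ![_, _] (by rw [Fin.sum_univ_two]; exact key)
  have h0 := this 0
  have h1 := this 1
  simp only [Matrix.cons_val_zero, Matrix.cons_val_one, Matrix.cons_val_fin_one] at h0 h1
  fin_cases a
  · simp only [Fin.zero_eta]; linarith
  · simp only [Fin.mk_one]; linarith

/-- raised tangential part of `E3` -/
def Tt (m l : ℝ) (φ : Pt 2 → Pt 3) (u : Pt 2) : Pt 3 :=
  ((fff (bcvMet m l) φ u)⁻¹ 0 0 * bom m l (φ u) (dmap φ u 0)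
    + (fff (bcvMet m l) φ u)⁻¹ 0 1 * bom m l (φ u) (dmap φ u 1)) • dmap φ u 0
  + ((fff (bcvMet m l) φ u)⁻¹ 1 0 * bom m l (φ u) (dmap φ u 0)
    + (fff (bcvMet m l) φ u)⁻¹ 1 1 * bom m l (φ u) (dmap φ u 1)) • dmap φ u 1

theorem E3_decomp (hdom : ∀ u, 0 < bcvF m (φ u)) (hli : ∀ u, LinearIndependent ℝ (dmap φ u))
    (hξ : IsUnitNormal (bcvMet m l) φ ξ) (u : Pt 2) :
    E3 = Tt m l φ u + bom m l (φ u) (ξ u) • ξ u := by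
  have hn : ∀ a, gip (bcvMet m l) (φ u) (dmap φ u a) (ξ u) = 0 := fun a => by
    rw [gip_symm]; exact hξ.2.2 u a
  rw [← sub_eq_zero]
  apply span_zero hdom hli hξ u
  · intro d
    simp only [Tt, gip_sub_left, gip_add_left, gip_smul_left, hξ.2.2, ← fff_apply]
    rw [gip_symm, gip_E3]
    have i0 := fff_inv (l := l) hdom hli u 0
    have i1 := fff_inv (l := l) hdom hli u 1
    have s := fff_inv_symm (m := m) (l := l) (φ := φ) u 0 1
    have i00 := i0 0
    have i01 := i0 1
    have i10 := i1 0
    have i11 := i1 1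
    simp only [if_true, if_false, Fin.isValue, zero_ne_one, one_ne_zero] at i00 i01 i10 i11
    rw [s] at *
    fin_cases d
    · simp only [Fin.zero_eta]
      linear_combination - bom m l (φ u) (dmap φ u 0) * i00 - bom m l (φ u) (dmap φ u 1) * i10
    · simp only [Fin.mk_one]
      linear_combination - bom m l (φ u) (dmap φ u 0) * i01 - bom m l (φ u) (dmap φ u 1) * i11
  · simp only [Tt, gip_sub_left, gip_add_left, gip_smul_left, hξ.2.1, hn]
    rw [gip_symm, gip_E3]; ring

/-- Laplacian of `lam` -/
def Lap (m l : ℝ) (φ : Pt 2 → Pt 3) (lam : Pt 2 → ℝ) (u : Pt 2) : ℝ :=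
  ∑ a, ∑ b, (fff (bcvMet m l) φ u)⁻¹ a b *
    (fderiv ℝ (fun q => fderiv ℝ lam q (bs b)) u (bs a)
      - ∑ c, christoffel (fff (bcvMet m l) φ) u c a b * fderiv ℝ lam u (bs c))

theorem bitension_eq (hφ : SV φ) (hdom : ∀ u, 0 < bcvF m (φ u)) (hli : ∀ u, LinearIndependent ℝ (dmap φ u))
    (hξ : IsUnitNormal (bcvMet m l) φ ξ) {lam : Pt 2 → ℝ}
    (hl : ∀ u a b, sff (bcvMet m l) φ ξ u a b = lam u * fff (bcvMet m l) φ u a b) (u : Pt 2) :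
    bitension (bcvMet m l) φ u =
      (2 * Lap m l φ lam u - 4 * lam u ^ 3 + 2 * lam u * (2 * (4 * m - 3 * l ^ 2 / 4)
        - (4 * m - l ^ 2) * (1 + bom m l (φ u) (ξ u) ^ 2))) • ξ u
      + (4 * lam u * (4 * m - l ^ 2) * bom m l (φ u) (ξ u)) • Tt m l φ u := by
  have hs := lam_smooth hφ hdom hli hξ hl
  have hn : ∀ a, gip (bcvMet m l) (φ u) (dmap φ u a) (ξ u) = 0 := fun a => by
    rw [gip_symm]; exact hξ.2.2 u a
  have hs2 : ContDiff ℝ (⊤ : ℕ∞) fun u => 2 * lam u := contDiff_const.mul hs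
  have hτ := tension_eq hφ hdom hli hξ hl
  have h1 : ∀ b, covAlong (bcvMet m l) φ (tension (bcvMet m l) φ) b
      = fun u => (2 * fderiv ℝ lam u (bs b)) • ξ u + (-(2 * (lam u * lam u))) • dmap φ u b := by
    intro b
    funext u
    rw [hτ, cov_smul hdom hs2 hξ.1, weingarten hφ hdom hli hξ hl]
    have : fderiv ℝ (fun u => 2 * lam u) u (bs b) = 2 * fderiv ℝ lam u (bs b) := by
      rw [((DD.const 2).mul (smooth_dd hs u b)).2]; ring
    rw [this, smul_smul]
    congr 2; ring
  have h2 : ∀ a b, covAlong (bcvMet m l) φ (covAlong (bcvMet m l) φ (tension (bcvMet m l) φ) b) a u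
      = (2 * fderiv ℝ (fun q => fderiv ℝ lam q (bs b)) u (bs a)) • ξ u
        + (2 * fderiv ℝ lam u (bs b)) • (-lam u) • dmap φ u a
        + ((-(4 * lam u * fderiv ℝ lam u (bs a))) • dmap φ u b
        + (-(2 * (lam u * lam u))) • (christoffel (fff (bcvMet m l) φ) u 0 a b • dmap φ u 0
        + christoffel (fff (bcvMet m l) φ) u 1 a b • dmap φ u 1
        + (lam u * fff (bcvMet m l) φ u a b) • ξ u)) := by
    intro a b
    have s1 : ContDiff ℝ (⊤ : ℕ∞) fun u => 2 * fderiv ℝ lam u (bs b) := contDiff_const.mul (smooth_fd hs b)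
    have s2 : ContDiff ℝ (⊤ : ℕ∞) fun u => -(2 * (lam u * lam u)) := (contDiff_const.mul (hs.mul hs)).neg
    rw [h1, cov_add hdom (SV_smul s1 hξ.1) (SV_smul s2 (hφ.dmap b)), cov_smul hdom s1 hξ.1,
      cov_smul hdom s2 (hφ.dmap b), weingarten hφ hdom hli hξ hl, gauss hφ hdom hli hξ, hl]
    have e1 : fderiv ℝ (fun u => 2 * fderiv ℝ lam u (bs b)) u (bs a)
        = 2 * fderiv ℝ (fun q => fderiv ℝ lam q (bs b)) u (bs a) := by
      rw [((DD.const 2).mul (smooth_dd (smooth_fd hs b) u a)).2]; ring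
    have e2 : fderiv ℝ (fun u => -(2 * (lam u * lam u))) u (bs a)
        = -(4 * lam u * fderiv ℝ lam u (bs a)) := by
      rw [((DD.const 2).mul ((smooth_dd hs u a).mul (smooth_dd hs u a))).neg.2]; ring
    rw [e1, e2]
  have hom2 : bom m l (φ u) ((2 * lam u) • ξ u) = 2 * lam u * bom m l (φ u) (ξ u) := by
    rw [← gip_E3, gip_smul_left, gip_E3]
  have hd := E3_decomp hdom hli hξ u
  have hc := codazzi hφ hdom hli hξ hl u
  have htr := trace_two (l := l) hdom hli u
  have hs1 : 1 = ((fff (bcvMet m l) φ u)⁻¹ 0 0 * bom m l (φ u) (dmap φ u 0)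
    + (fff (bcvMet m l) φ u)⁻¹ 0 1 * bom m l (φ u) (dmap φ u 1)) * bom m l (φ u) (dmap φ u 0)
  + ((fff (bcvMet m l) φ u)⁻¹ 1 0 * bom m l (φ u) (dmap φ u 0)
    + (fff (bcvMet m l) φ u)⁻¹ 1 1 * bom m l (φ u) (dmap φ u 1)) * bom m l (φ u) (dmap φ u 1)
    + bom m l (φ u) (ξ u) * bom m l (φ u) (ξ u) := by
    have := congrArg (fun v => gip (bcvMet m l) (φ u) v E3) hd
    simp only [Tt, gip_add_left, gip_smul_left] at this
    simpa only [gip_E3, bom_E3] using this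
  have hsy := fff_inv_symm (m := m) (l := l) (φ := φ) u 0 1
  funext k
  have hdk := congrFun hd k
  simp only [Tt, Pi.add_apply, Pi.smul_apply, smul_eq_mul] at hdk
  simp only [bitension, h2]
  simp only [curv_Rm l (hdom u).ne', Rm, h1]
  simp only [hτ, hn, hom2, gip_smul_left, gip_smul_right, hξ.2.2, ← fff_apply, Tt, Lap,
    Pi.add_apply, Pi.smul_apply, smul_eq_mul, hc]
  simp only [Fin.sum_univ_two] at htr ⊢
  rw [hdk]
  rw [hsy] at hs1 htr ⊢
  generalize (fff (bcvMet m l) φ u)⁻¹ 0 0 = P0 at *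
  generalize (fff (bcvMet m l) φ u)⁻¹ 1 0 = P1 at *
  generalize (fff (bcvMet m l) φ u)⁻¹ 1 1 = P2 at *
  generalize bom m l (φ u) (ξ u) = θ at *
  generalize bom m l (φ u) (dmap φ u 0) = t0 at *
  generalize bom m l (φ u) (dmap φ u 1) = t1 at *
  linear_combination (ξ u k * (-2 * lam u ^ 3 + 2 * lam u * (4 * m - 3 * l ^ 2 / 4)) - 
     2 * lam u * θ * (4 * m - l ^ 2) * ((P0 * t0 + P1 * t1) * dmap φ u 0 k + (P1 * t0 + P2 * t1) * dmap φ u 1 k + θ * ξ u k)) * htr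
     + 2 * lam u * (4 * m - l ^ 2) * ξ u k * hs1

end final

theorem lam_const {f : Pt 2 → ℝ} (hf : ContDiff ℝ (⊤ : ℕ∞) f) (h : ∀ u c, fderiv ℝ f u (bs c) = 0)
    (u v : Pt 2) : f u = f v := by
  refine is_const_of_fderiv_eq_zero (𝕜 := ℝ) (hf.differentiable (by simp)) (fun w => ?_) u v
  ext x
  have : x = x 0 • bs 0 + x 1 • bs 1 := by
    funext k; fin_cases k <;> simp [bs]
  rw [this, map_add, map_smul, map_smul, h, h]
  simp

section main
variable {m l : ℝ} {φ ξ : Pt 2 → Pt 3}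

theorem gip_Tt (hdom : ∀ u, 0 < bcvF m (φ u)) (hli : ∀ u, LinearIndependent ℝ (dmap φ u))
    (hξ : IsUnitNormal (bcvMet m l) φ ξ) (u : Pt 2) :
    (∀ c, gip (bcvMet m l) (φ u) (Tt m l φ u) (dmap φ u c) = bom m l (φ u) (dmap φ u c)) ∧
    gip (bcvMet m l) (φ u) (Tt m l φ u) (ξ u) = 0 := by
  have hd := E3_decomp hdom hli hξ u
  constructor
  · intro c
    have := congrArg (fun v => gip (bcvMet m l) (φ u) v (dmap φ u c)) hd
    simp only [gip_add_left, gip_smul_left, hξ.2.2] at this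
    rw [gip_symm, gip_E3] at this
    linarith
  · have hn : ∀ a, gip (bcvMet m l) (φ u) (dmap φ u a) (ξ u) = 0 := fun a => by
      rw [gip_symm]; exact hξ.2.2 u a
    simp only [Tt, gip_add_left, gip_smul_left, hn]; ring

theorem Lap_zero {lam : Pt 2 → ℝ} (h : ∀ u c, fderiv ℝ lam u (bs c) = 0) (u : Pt 2) :
    Lap m l φ lam u = 0 := by
  simp only [Lap, h]
  simp

theorem cov_E3 (hdom : ∀ u, 0 < bcvF m (φ u)) (a : Fin 2) (u : Pt 2) :
    covAlong (bcvMet m l) φ (fun _ => E3) a u = Gam m l (φ u) (dmap φ u a) E3 := by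
  rw [covA hdom]
  have : dmap (fun _ : Pt 2 => E3) u a = 0 := by
    funext k; simp [dmap]
  rw [this, zero_add]

theorem theta_zero (hφ : SV φ) (hdom : ∀ u, 0 < bcvF m (φ u)) (hli : ∀ u, LinearIndependent ℝ (dmap φ u))
    (hξ : IsUnitNormal (bcvMet m l) φ ξ) {lam : Pt 2 → ℝ}
    (hl : ∀ u a b, sff (bcvMet m l) φ ξ u a b = lam u * fff (bcvMet m l) φ u a b)
    (h0 : ∀ u, bom m l (φ u) (ξ u) = 0) (u : Pt 2) : lam u = 0 := by
  have hc : ∀ a, lam u * bom m l (φ u) (dmap φ u a)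
      = gip (bcvMet m l) (φ u) (ξ u) (Gam m l (φ u) E3 (dmap φ u a)) := by
    intro a
    have h := compat (l := l) hφ hdom hξ.1 (Y := fun _ => E3) (fun k => contDiff_const) a u
    simp only [gip_E3, h0, cov_E3 hdom, weingarten hφ hdom hli hξ hl] at h
    rw [Gam_symm, ← gip_E3, gip_smul_left, gip_E3] at h
    simp at h
    linarith
  have hd := E3_decomp hdom hli hξ u
  rw [h0, zero_smul, add_zero] at hd
  have h1 : bom m l (φ u) E3 = 1 := bom_E3 _ _ _
  have h2 : gip (bcvMet m l) (φ u) (ξ u) (Gam m l (φ u) E3 E3) = 0 := by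
    rw [Gam_E3_E3, gip_symm, gip_zero_left]
  obtain ⟨x, y, hxy⟩ : ∃ x y : ℝ, E3 = x • dmap φ u 0 + y • dmap φ u 1 := ⟨_, _, hd⟩
  have h3 : Gam m l (φ u) E3 E3 = x • Gam m l (φ u) E3 (dmap φ u 0) + y • Gam m l (φ u) E3 (dmap φ u 1) := by
    conv_lhs => rw [show Gam m l (φ u) E3 E3 = Gam m l (φ u) E3 (x • dmap φ u 0 + y • dmap φ u 1) by rw [← hxy]]
    rw [Gam_add_right, Gam_smul_right, Gam_smul_right]
  have h4 : bom m l (φ u) E3 = x * bom m l (φ u) (dmap φ u 0) + y * bom m l (φ u) (dmap φ u 1) := by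
    rw [← gip_E3 m l _ (dmap φ u 0), ← gip_E3 m l _ (dmap φ u 1), ← gip_smul_left, ← gip_smul_left,
      ← gip_add_left, ← hxy, gip_E3]
  rw [h3, gip_add_right, gip_smul_right, gip_smul_right, ← hc, ← hc] at h2
  rw [h1] at h4
  linear_combination h2 + lam u * h4

theorem t_zero (hφ : SV φ) (hdom : ∀ u, 0 < bcvF m (φ u)) (hli : ∀ u, LinearIndependent ℝ (dmap φ u))
    (hξ : IsUnitNormal (bcvMet m l) φ ξ) {lam : Pt 2 → ℝ}
    (hl : ∀ u a b, sff (bcvMet m l) φ ξ u a b = lam u * fff (bcvMet m l) φ u a b)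
    (h0 : ∀ u c, bom m l (φ u) (dmap φ u c) = 0) (u : Pt 2) : bom m l (φ u) (ξ u) * lam u = 0 := by
  have h := compat (l := l) hφ hdom (hφ.dmap 0) (Y := fun _ => E3) (fun k => contDiff_const) 0 u
  have hd := E3_decomp hdom hli hξ u
  have hT : Tt m l φ u = 0 := by simp [Tt, h0]
  rw [hT, zero_add] at hd
  simp only [gip_E3, h0, cov_E3 hdom] at h
  rw [gip_symm m l _ (dmap φ u 0), gip_Gam_E3 hdom, add_zero, ← gip_E3, hd, gip_smul_right, ← sff_eq,
    hl] at h
  simp at h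
  have := (fff_pos (l := l) hdom hli u 0).ne'
  rcases h with h | h | h
  · rw [h, zero_mul]
  · rw [h, mul_zero]
  · exact absurd h this

end main

/-- Corollary 3.4. A totally umbilical surface in a 3-dimensional
Bianchi–Cartan–Vranceanu space `M³_{m,l}` is proper biharmonic if and only if it is part
of `S²(1/√(2m))` in `S³(1/√m)`: that is, `l² = 4m > 0` (so `M³_{m,l}` is `S³(1/√m)`) and
the (totally umbilical) surface satisfies `H² = m`, which characterises exactly the parts
of `S²(1/√(2m))` among totally umbilical surfaces in `S³(1/√m)`. -/
theorem totally_umbilical_proper_biharmonic_in_BCV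
    (m l : ℝ) (φ ξ : Pt 2 → Pt 3)
    (hφ : IsImmersion φ) (hξ : IsUnitNormal (bcvMet m l) φ ξ)
    (hdom : ∀ u, 0 < bcvF m (φ u))
    (humb : IsTotallyUmbilical (bcvMet m l) φ ξ) :
    IsProperBiharmonic (bcvMet m l) φ ↔
      l ^ 2 = 4 * m ∧ 0 < m ∧ ∀ u, meanCurv (bcvMet m l) φ ξ u ^ 2 = m := by
  obtain ⟨hsm, hli⟩ := hφ
  have hsm : SV φ := hsm
  obtain ⟨lam, hl⟩ := humb
  have hs := lam_smooth hsm hdom hli hξ hl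
  have hc := codazzi hsm hdom hli hξ hl
  have hb := bitension_eq hsm hdom hli hξ hl
  have hτ := tension_eq hsm hdom hli hξ hl
  have hG := gip_Tt hdom hli hξ
  simp only [meanCurv_eq hdom hli hl]
  constructor
  · rintro ⟨hbi, hnm⟩
    have hbz : ∀ u, bitension (bcvMet m l) φ u = 0 := hbi
    have hll : ∀ u c, lam u * fderiv ℝ lam u (bs c) = 0 := by
      intro u c
      have h := congrArg (fun v => gip (bcvMet m l) (φ u) v (dmap φ u c)) ((hb u).symm.trans (hbz u))
      simp only [gip_add_left, gip_smul_left, hξ.2.2, (hG u).1, gip_zero_left] at h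
      rw [hc]; linarith
    have hsq : ∀ u v, lam u * lam u = lam v * lam v := by
      intro u v
      refine lam_const (f := fun u => lam u * lam u) (hs.mul hs) (fun w c => ?_) u v
      rw [((smooth_dd hs w c).mul (smooth_dd hs w c)).2]
      linarith [hll w c]
    obtain ⟨u0, hu0⟩ : ∃ u, lam u ≠ 0 := by
      by_contra hcon
      push Not at hcon
      apply hnm
      intro u
      rw [hτ]; simp [hcon]
    have hne : ∀ u, lam u ≠ 0 := by
      intro u h
      have := hsq u u0
      rw [h, mul_zero] at this
      exact hu0 (mul_self_eq_zero.1 this.symm)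
    have hld : ∀ u c, fderiv ℝ lam u (bs c) = 0 := fun u c =>
      (mul_eq_zero.1 (hll u c)).resolve_left (hne u)
    have hform : ∀ u, 2 * lam u ^ 2 = 2 * (4 * m - 3 * l ^ 2 / 4)
        - (4 * m - l ^ 2) * (1 + bom m l (φ u) (ξ u) ^ 2) := by
      intro u
      have h := congrArg (fun v => gip (bcvMet m l) (φ u) v (ξ u)) ((hb u).symm.trans (hbz u))
      simp only [gip_add_left, gip_smul_left, hξ.2.1, (hG u).2, gip_zero_left, Lap_zero hld] at h
      have : lam u * (2 * lam u ^ 2 - (2 * (4 * m - 3 * l ^ 2 / 4)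
        - (4 * m - l ^ 2) * (1 + bom m l (φ u) (ξ u) ^ 2))) = 0 := by linear_combination (-1/2) * h
      linarith [(mul_eq_zero.1 this).resolve_left (hne u)]
    by_cases hk : l ^ 2 = 4 * m
    · have hm : ∀ u, lam u ^ 2 = m := by
        intro u
        have := hform u
        rw [hk] at this
        linarith
      exact ⟨hk, by rw [← hm u0]; exact by have := hne u0; positivity, hm⟩
    · exfalso
      have hk' : 4 * m - l ^ 2 ≠ 0 := fun h => hk (by linarith)
      have htt : ∀ u c, bom m l (φ u) (ξ u) * bom m l (φ u) (dmap φ u c) = 0 := by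
        intro u c
        have h := hc u c
        rw [hld] at h
        have : (4 * m - l ^ 2) * (bom m l (φ u) (ξ u) * bom m l (φ u) (dmap φ u c)) = 0 := by linarith
        exact (mul_eq_zero.1 this).resolve_left hk'
      have hth : ∀ u v, bom m l (φ u) (ξ u) ^ 2 = bom m l (φ v) (ξ v) ^ 2 := by
        intro u v
        have : (4 * m - l ^ 2) * (bom m l (φ u) (ξ u) ^ 2 - bom m l (φ v) (ξ v) ^ 2) = 0 := by
          linear_combination hform u - hform v - 2 * hsq u v
        linarith [(mul_eq_zero.1 this).resolve_left hk']
      by_cases h0 : bom m l (φ u0) (ξ u0) = 0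
      · refine hu0 (theta_zero hsm hdom hli hξ hl (fun u => ?_) u0)
        have := hth u u0
        rw [h0] at this
        exact pow_eq_zero_iff (two_ne_zero) |>.1 (by simpa using this)
      · have hne2 : ∀ u, bom m l (φ u) (ξ u) ≠ 0 := by
          intro u h
          have := hth u0 u
          rw [h] at this
          exact h0 (pow_eq_zero_iff (two_ne_zero) |>.1 (by simpa using this))
        exact mul_ne_zero h0 hu0 (t_zero hsm hdom hli hξ hl
          (fun u c => (mul_eq_zero.1 (htt u c)).resolve_left (hne2 u)) u0)
  · rintro ⟨hk, hm, hH⟩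
    have hld : ∀ u c, fderiv ℝ lam u (bs c) = 0 := by
      intro u c
      rw [hc, hk]; ring
    constructor
    · intro u
      have : 4 * m - l ^ 2 = 0 := by linarith
      rw [hb, Lap_zero hld, this]
      have e : 2 * 0 - 4 * lam u ^ 3 + 2 * lam u * (2 * (4 * m - 3 * l ^ 2 / 4)
        - 0 * (1 + bom m l (φ u) (ξ u) ^ 2)) = 0 := by
        rw [hk]
        linear_combination (-4 * lam u) * hH u
      rw [e]; simp
    · intro hmin
      have h0 : tension (bcvMet m l) φ 0 = 0 := hmin 0
      rw [hτ] at h0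
      have h := congrArg (fun v => gip (bcvMet m l) (φ 0) v (ξ 0)) h0
      simp only [gip_smul_left, hξ.2.1, gip_zero_left] at h
      have := hH 0
      have h1 : lam 0 = 0 := by linarith
      rw [h1] at this
      simp at this
      linarith
end
end
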